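/- arXiv:1302.7315 — 2 statements merged into one kernel-verified Lean document; each statement's English description precedes it below -/
import Mathlib

section
/- Let 1 < p < ∞. Then the union over w ∈ A_p(ℝ^n) of L^p_w(ℝ^n) equals the intersection of 𝓜_{A₁}(ℝ^n) with the union over w ∈ A₁(ℝ^n) of L^1_w(ℝ^n); that is, f ∈ L^p_w(ℝ^n) for some w ∈ A_p(ℝ^n) if and only if f has an A₁(ℝ^n) majorant and f ∈ L^1_u(ℝ^n) for some u ∈ A₁(ℝ^n). -/
open MeasureTheory ENNReal

/-- A (nondegenerate) cube in `ℝⁿ` with sides parallel to the axes. -/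
def IsCube {n : ℕ} (Q : Set (Fin n → ℝ)) : Prop :=
  ∃ (a : Fin n → ℝ) (l : ℝ), 0 < l ∧
    Q = Set.univ.pi fun i => Set.Icc (a i) (a i + l)

/-- The domains considered: all of `ℝⁿ` or a cube with sides parallel to the axes. -/
def IsAdmissibleDomain {n : ℕ} (Ω : Set (Fin n → ℝ)) : Prop :=
  Ω = Set.univ ∨ IsCube Ω

/-- The Hardy–Littlewood maximal operator restricted to `Ω`:
`M_Ω f (x) = sup { (1/|Q|) ∫_Q |f| : Q ⊆ Ω a cube with x ∈ Q }`. -/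
noncomputable def maximal {n : ℕ} (Ω : Set (Fin n → ℝ)) (f : (Fin n → ℝ) → ℝ)
    (x : Fin n → ℝ) : ℝ≥0∞ :=
  ⨆ (Q : Set (Fin n → ℝ)) (_ : IsCube Q) (_ : Q ⊆ Ω) (_ : x ∈ Q),
    (volume Q)⁻¹ * ∫⁻ y in Q, ENNReal.ofReal |f y|

/-- A weight on `Ω`: a measurable function, positive a.e. on `Ω`, integrable on every
cube contained in `Ω` (hence locally integrable; integrable when `Ω` is itself a cube). -/
structure IsWeight {n : ℕ} (Ω : Set (Fin n → ℝ)) (w : (Fin n → ℝ) → ℝ) : Prop where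
  measurable : Measurable w
  pos : ∀ᵐ x ∂(volume.restrict Ω), 0 < w x
  locInt : ∀ Q : Set (Fin n → ℝ), IsCube Q → Q ⊆ Ω → IntegrableOn w Q

/-- The Muckenhoupt `A₁(Ω)` class: `M_Ω w ≤ C w` a.e. on `Ω`. -/
def MemA1 {n : ℕ} (Ω : Set (Fin n → ℝ)) (w : (Fin n → ℝ) → ℝ) : Prop :=
  IsWeight Ω w ∧ ∃ C : ℝ, ∀ᵐ x ∂(volume.restrict Ω),
    maximal Ω w x ≤ ENNReal.ofReal (C * w x)

/-- The Muckenhoupt `A_p(Ω)` class for `1 < p < ∞`: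
`sup_{Q ⊆ Ω} (avg_Q w) * (avg_Q w^(1-p'))^(p-1) < ∞` where `p' = p/(p-1)`. -/
def MemApGT1 {n : ℕ} (Ω : Set (Fin n → ℝ)) (p : ℝ) (w : (Fin n → ℝ) → ℝ) : Prop :=
  IsWeight Ω w ∧ ∃ C : ℝ≥0∞, C ≠ ∞ ∧ ∀ Q : Set (Fin n → ℝ), IsCube Q → Q ⊆ Ω →
    ((volume Q)⁻¹ * ∫⁻ x in Q, ENNReal.ofReal (w x)) *
      ((volume Q)⁻¹ * ∫⁻ x in Q, ENNReal.ofReal (w x ^ (1 - p / (p - 1)))) ^ (p - 1) ≤ C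

/-- The Muckenhoupt `A_p(Ω)` class for `1 ≤ p < ∞`. -/
def MemA {n : ℕ} (Ω : Set (Fin n → ℝ)) (p : ℝ) (w : (Fin n → ℝ) → ℝ) : Prop :=
  (p = 1 ∧ MemA1 Ω w) ∨ (1 < p ∧ MemApGT1 Ω p w)

/-- The Muckenhoupt `A_∞(Ω)` class: the union of `A_p(Ω)` over `1 ≤ p < ∞`. -/
def MemAInf {n : ℕ} (Ω : Set (Fin n → ℝ)) (w : (Fin n → ℝ) → ℝ) : Prop :=
  ∃ p : ℝ, 1 ≤ p ∧ MemA Ω p w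

/-- Membership in the weighted Lebesgue space `L^p_w(Ω)`: `f` measurable with
`∫_Ω |f|^p w < ∞`. -/
def MemLw {n : ℕ} (Ω : Set (Fin n → ℝ)) (p : ℝ) (w f : (Fin n → ℝ) → ℝ) : Prop :=
  Measurable f ∧
    ∫⁻ x in Ω, ENNReal.ofReal |f x| ^ p * ENNReal.ofReal (w x) < ⊤

/-- Membership in the (unweighted) Lebesgue space `L^p(Ω)`. -/
def MemLeb {n : ℕ} (Ω : Set (Fin n → ℝ)) (p : ℝ) (f : (Fin n → ℝ) → ℝ) : Prop :=
  MemLw Ω p (fun _ => 1) f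

/-- `f ∈ 𝓜_{A_p}(Ω)`: `f` is measurable and `|f| ≤ w` a.e. on `Ω` for some `w ∈ A_p(Ω)`. -/
def HasApMajorant {n : ℕ} (Ω : Set (Fin n → ℝ)) (p : ℝ) (f : (Fin n → ℝ) → ℝ) : Prop :=
  Measurable f ∧ ∃ w, MemA Ω p w ∧ ∀ᵐ x ∂(volume.restrict Ω), |f x| ≤ w x

/-- `f ∈ 𝓜^r_{A_p}(Ω)`: `f` is measurable and `|f|^r ≤ w` a.e. on `Ω` for some
`w ∈ A_p(Ω)`. -/
def HasApPowMajorant {n : ℕ} (Ω : Set (Fin n → ℝ)) (p r : ℝ) (f : (Fin n → ℝ) → ℝ) : Prop :=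
  Measurable f ∧ ∃ w, MemA Ω p w ∧ ∀ᵐ x ∂(volume.restrict Ω), |f x| ^ r ≤ w x

/-- `f ∈ 𝓜_{A_∞}(Ω)`: `f` is measurable and `|f| ≤ w` a.e. on `Ω` for some `w ∈ A_∞(Ω)`. -/
def HasAInfMajorant {n : ℕ} (Ω : Set (Fin n → ℝ)) (f : (Fin n → ℝ) → ℝ) : Prop :=
  Measurable f ∧ ∃ w, MemAInf Ω w ∧ ∀ᵐ x ∂(volume.restrict Ω), |f x| ≤ w x

/-- Membership in weak `L^p(ℝⁿ)`: `sup_{t>0} t · |{|f| > t}|^{1/p} < ∞`. -/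
def MemWeakLp {n : ℕ} (p : ℝ) (f : (Fin n → ℝ) → ℝ) : Prop :=
  Measurable f ∧ ∃ C : ℝ≥0∞, C ≠ ⊤ ∧ ∀ t : ℝ, 0 < t →
    ENNReal.ofReal t * volume {x | t < |f x|} ^ (1 / p) ≤ C

/-- The centered maximal function with respect to `μ`, with radii restricted to powers of two. -/
noncomputable def dyadicMax {n : ℕ} (μ : Measure (Fin n → ℝ)) (g : (Fin n → ℝ) → ℝ≥0∞)
    (x : Fin n → ℝ) : ℝ≥0∞ :=
  ⨆ k : ℤ, (μ (Metric.closedBall x ((2 : ℝ) ^ k)))⁻¹ *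
    ∫⁻ y in Metric.closedBall x ((2 : ℝ) ^ k), g y ∂μ

lemma measurable_setLIntegral_closedBall {n : ℕ} (μ : Measure (Fin n → ℝ)) [SFinite μ]
    {g : (Fin n → ℝ) → ℝ≥0∞} (hg : Measurable g) (r : ℝ) :
    Measurable fun x => ∫⁻ y in Metric.closedBall x r, g y ∂μ := by
  have hs : MeasurableSet {z : (Fin n → ℝ) × (Fin n → ℝ) | dist z.2 z.1 ≤ r} :=
    measurableSet_le (measurable_snd.dist measurable_fst) measurable_const
  have h := ((hg.comp measurable_snd).indicator hs).lintegral_prod_right' (ν := μ)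
  convert h using 2 with x
  rw [← lintegral_indicator Metric.isClosed_closedBall.measurableSet]
  rfl

lemma measurable_dyadicMax {n : ℕ} (μ : Measure (Fin n → ℝ)) [SFinite μ]
    {g : (Fin n → ℝ) → ℝ≥0∞} (hg : Measurable g) : Measurable (dyadicMax μ g) := by
  refine Measurable.iSup fun k => Measurable.mul (Measurable.inv ?_)
    (measurable_setLIntegral_closedBall μ hg _)
  simpa using measurable_setLIntegral_closedBall μ (measurable_const (a := (1 : ℝ≥0∞))) ((2 : ℝ) ^ k)

/-- The weak type `(1,1)` bound for the centered maximal function, uniformly in the measure. -/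
lemma exists_weak_type_dyadicMax (n : ℕ) : ∃ N : ℕ, ∀ (μ : Measure (Fin n → ℝ))
    (g : (Fin n → ℝ) → ℝ≥0∞) (t : ℝ≥0∞),
    t * μ {x | t < dyadicMax μ g x} ≤ N * ∫⁻ x, g x ∂μ := by
  obtain ⟨N, τ, hτ, hN⟩ := HasBesicovitchCovering.no_satelliteConfig (α := Fin n → ℝ)
  refine ⟨N, fun μ g t => ?_⟩
  set E : ℕ → Set (Fin n → ℝ) := fun K => {x | ∃ k : ℤ, k ≤ K ∧
    t < (μ (Metric.closedBall x ((2 : ℝ) ^ k)))⁻¹ *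
      ∫⁻ y in Metric.closedBall x ((2 : ℝ) ^ k), g y ∂μ} with hE
  have hEmono : Monotone E := by
    rintro K L hKL x ⟨k, hk, h⟩
    exact ⟨k, hk.trans (by exact_mod_cast hKL), h⟩
  have hU : {x | t < dyadicMax μ g x} = ⋃ K, E K := by
    ext x
    simp only [Set.mem_ofPred_eq, dyadicMax, lt_iSup_iff, Set.mem_iUnion, hE]
    constructor
    · rintro ⟨k, hk⟩
      exact ⟨k.toNat, k, Int.self_le_toNat k, hk⟩
    · rintro ⟨K, k, _, hk⟩
      exact ⟨k, hk⟩
  rw [hU, hEmono.measure_iUnion, ENNReal.mul_iSup]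
  refine iSup_le fun K => ?_
  have hx : ∀ x : E K, ∃ k : ℤ, k ≤ K ∧
    t < (μ (Metric.closedBall x.1 ((2 : ℝ) ^ k)))⁻¹ *
      ∫⁻ y in Metric.closedBall x.1 ((2 : ℝ) ^ k), g y ∂μ := fun x => x.2
  choose k hkK hk using hx
  have hk' : ∀ x : E K, t * μ (Metric.closedBall x.1 ((2 : ℝ) ^ (k x))) ≤
      ∫⁻ y in Metric.closedBall x.1 ((2 : ℝ) ^ (k x)), g y ∂μ := by
    intro x
    rcases eq_or_ne (μ (Metric.closedBall x.1 ((2 : ℝ) ^ (k x)))) ⊤ with h | h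
    · have := hk x
      simp [h] at this
    rcases eq_or_ne (μ (Metric.closedBall x.1 ((2 : ℝ) ^ (k x)))) 0 with h0 | h0
    · simp [h0]
    have := (hk x).le
    rw [mul_comm, ← div_eq_mul_inv, ENNReal.le_div_iff_mul_le (Or.inl h0) (Or.inl h)] at this
    exact this
  let q : Besicovitch.BallPackage (E K) (Fin n → ℝ) :=
    { c := fun x => x.1
      r := fun x => (2 : ℝ) ^ (k x)
      rpos := fun x => by positivity
      r_bound := (2 : ℝ) ^ (K : ℤ)
      r_le := fun x => zpow_le_zpow_right₀ (by norm_num) (hkK x) }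
  obtain ⟨s, hs, hcov⟩ := Besicovitch.exist_disjoint_covering_families hτ hN q
  have hcount : ∀ i, (s i).Countable := fun i =>
    (hs i).countable_of_nonempty_interior fun j _ =>
      ⟨q.c j, Metric.ball_subset_interior_closedBall (Metric.mem_ball_self (q.rpos j))⟩
  have hsub : E K ⊆ ⋃ i : Fin N, ⋃ j ∈ s i, Metric.closedBall (q.c j) (q.r j) := by
    intro x hxE
    have h1 := hcov ⟨⟨x, hxE⟩, rfl⟩
    simp only [Set.mem_iUnion] at h1 ⊢
    obtain ⟨i, j, hj, h⟩ := h1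
    exact ⟨i, j, hj, Metric.ball_subset_closedBall h⟩
  calc t * μ (E K)
      ≤ t * ∑ i : Fin N, μ (⋃ j ∈ s i, Metric.closedBall (q.c j) (q.r j)) := by
        gcongr
        exact (measure_mono hsub).trans (measure_iUnion_fintype_le _ _)
    _ = ∑ i : Fin N, t * μ (⋃ j ∈ s i, Metric.closedBall (q.c j) (q.r j)) := Finset.mul_sum ..
    _ ≤ ∑ _i : Fin N, ∫⁻ x, g x ∂μ := by
        refine Finset.sum_le_sum fun i _ => ?_
        have := (hcount i).to_subtype
        calc t * μ (⋃ j ∈ s i, Metric.closedBall (q.c j) (q.r j))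
            ≤ t * ∑' j : s i, μ (Metric.closedBall (q.c j) (q.r j)) := by
              gcongr
              exact measure_biUnion_le _ (hcount i) _
          _ = ∑' j : s i, t * μ (Metric.closedBall (q.c j) (q.r j)) := ENNReal.tsum_mul_left.symm
          _ ≤ ∑' j : s i, ∫⁻ y in Metric.closedBall (q.c j) (q.r j), g y ∂μ :=
              ENNReal.tsum_le_tsum fun j => hk' j
          _ = ∫⁻ y in ⋃ j ∈ s i, Metric.closedBall (q.c j) (q.r j), g y ∂μ :=
              (lintegral_biUnion (hcount i)
                (fun j _ => Metric.isClosed_closedBall.measurableSet) (hs i) _).symm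
          _ ≤ ∫⁻ y, g y ∂μ := setLIntegral_le_lintegral _ _
    _ = N * ∫⁻ x, g x ∂μ := by simp

lemma lintegral_Ioi_rpow_lt_ofReal {s b : ℝ} (hs : 0 < s) (hb : 0 ≤ b) :
    ∫⁻ t in Set.Ioi (0 : ℝ), (if ENNReal.ofReal t < ENNReal.ofReal b then
      ENNReal.ofReal (t ^ (s - 1)) else 0) = ENNReal.ofReal b ^ s / ENNReal.ofReal s := by
  have h1 : ∀ t ∈ Set.Ioi (0 : ℝ), (if ENNReal.ofReal t < ENNReal.ofReal b then
      ENNReal.ofReal (t ^ (s - 1)) else 0) =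
      (Set.Iio b).indicator (fun t => ENNReal.ofReal (t ^ (s - 1))) t := by
    intro t ht
    simp only [Set.indicator, Set.mem_Iio, ENNReal.ofReal_lt_ofReal_iff_of_nonneg (le_of_lt ht)]
  rw [setLIntegral_congr_fun measurableSet_Ioi h1, setLIntegral_indicator measurableSet_Iio,
    Set.Iio_inter_Ioi, setLIntegral_congr Ioo_ae_eq_Ioc,
    ← ofReal_integral_eq_lintegral_ofReal]
  · rw [← intervalIntegral.integral_of_le hb, integral_rpow (Or.inl (by linarith)),
      sub_add_cancel, Real.zero_rpow hs.ne', sub_zero, ENNReal.ofReal_div_of_pos hs,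
      ENNReal.ofReal_rpow_of_nonneg hb hs.le]
  · exact (intervalIntegrable_iff_integrableOn_Ioc_of_le hb).1
      (intervalIntegral.intervalIntegrable_rpow' (by linarith))
  · filter_upwards [ae_restrict_mem measurableSet_Ioc] with t ht
    exact Real.rpow_nonneg ht.1.le _

/-- The layer cake formula for a single extended nonnegative number. -/
lemma lintegral_Ioi_rpow_lt {s : ℝ} (hs : 0 < s) (a : ℝ≥0∞) :
    ∫⁻ t in Set.Ioi (0 : ℝ), (if ENNReal.ofReal t < a then
      ENNReal.ofReal (t ^ (s - 1)) else 0) = a ^ s / ENNReal.ofReal s := by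
  rcases eq_or_ne a ⊤ with rfl | ha
  · rw [ENNReal.top_rpow_of_pos hs, ENNReal.top_div_of_ne_top ENNReal.ofReal_ne_top]
    have key : ∀ m : ℕ, ENNReal.ofReal m ^ s / ENNReal.ofReal s ≤
        ∫⁻ t in Set.Ioi (0 : ℝ), (if ENNReal.ofReal t < ⊤ then
          ENNReal.ofReal (t ^ (s - 1)) else 0) := by
      intro m
      rw [← lintegral_Ioi_rpow_lt_ofReal hs m.cast_nonneg]
      refine lintegral_mono fun t => ?_
      split_ifs <;> simp_all
    have hlim : Filter.Tendsto (fun m : ℕ => ENNReal.ofReal m ^ s / ENNReal.ofReal s)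
        Filter.atTop (nhds ((⊤ : ℝ≥0∞) ^ s / ENNReal.ofReal s)) := by
      simp only [ENNReal.ofReal_natCast]
      exact ENNReal.Tendsto.div_const (ENNReal.tendsto_nat_nhds_top.ennrpow_const s)
        (Or.inl (by simp [ENNReal.top_rpow_of_pos hs]))
    have := le_of_tendsto' (b := ∫⁻ t in Set.Ioi (0 : ℝ), (if ENNReal.ofReal t < ⊤ then
          ENNReal.ofReal (t ^ (s - 1)) else 0)) hlim key
    rwa [ENNReal.top_rpow_of_pos hs, ENNReal.top_div_of_ne_top ENNReal.ofReal_ne_top,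
      top_le_iff] at this
  · have := lintegral_Ioi_rpow_lt_ofReal hs (b := a.toReal) ENNReal.toReal_nonneg
    rwa [ENNReal.ofReal_toReal ha] at this

lemma dyadicMax_le_truncation {n : ℕ} (μ : Measure (Fin n → ℝ)) {g : (Fin n → ℝ) → ℝ≥0∞}
    (t : ℝ≥0∞) (x : Fin n → ℝ) :
    dyadicMax μ g x ≤ dyadicMax μ (fun y => if t < 2 * g y then g y else 0) x + t / 2 := by
  refine iSup_le fun k => ?_
  set B := Metric.closedBall x ((2 : ℝ) ^ k)
  calc (μ B)⁻¹ * ∫⁻ y in B, g y ∂μ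
      ≤ (μ B)⁻¹ * ∫⁻ y in B, ((if t < 2 * g y then g y else 0) + t / 2) ∂μ := by
        gcongr with y
        split_ifs with h
        · exact le_self_add
        · rw [zero_add, ENNReal.le_div_iff_mul_le (by simp) (by simp), mul_comm]
          exact not_lt.1 h
    _ = (μ B)⁻¹ * ∫⁻ y in B, (if t < 2 * g y then g y else 0) ∂μ + (μ B)⁻¹ * (t / 2 * μ B) := by
        rw [lintegral_add_right _ measurable_const, mul_add, setLIntegral_const]
    _ ≤ _ := by
        gcongr
        · exact le_iSup (fun k : ℤ => (μ (Metric.closedBall x ((2 : ℝ) ^ k)))⁻¹ *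
            ∫⁻ y in Metric.closedBall x ((2 : ℝ) ^ k), (if t < 2 * g y then g y else 0) ∂μ) k
        · rw [mul_left_comm]
          exact mul_le_of_le_one_right' (ENNReal.inv_mul_le_one _)

/-- The strong type `(p,p)` bound for the centered maximal function, uniformly in the measure. -/
lemma exists_strong_type_dyadicMax (n : ℕ) {p : ℝ} (hp : 1 < p) : ∃ K : ℝ≥0∞, K ≠ ⊤ ∧
    ∀ (μ : Measure (Fin n → ℝ)) [SFinite μ] (g : (Fin n → ℝ) → ℝ≥0∞), Measurable g →
    ∫⁻ x, dyadicMax μ g x ^ p ∂μ ≤ K * ∫⁻ x, g x ^ p ∂μ := by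
  obtain ⟨N, hN⟩ := exists_weak_type_dyadicMax n
  have hp0 : 0 < p := by linarith
  have hp1 : 0 < p - 1 := by linarith
  refine ⟨ENNReal.ofReal p * (2 * N) * (2 ^ (p - 1) / ENNReal.ofReal (p - 1)), ?_, ?_⟩
  · refine ENNReal.mul_ne_top (ENNReal.mul_ne_top ENNReal.ofReal_ne_top
      (ENNReal.mul_ne_top (by simp) (by simp))) (ENNReal.div_ne_top ?_ (by simpa using hp))
    exact ENNReal.rpow_ne_top_of_nonneg hp1.le (by simp)
  intro μ _ g hg
  have hM := measurable_dyadicMax μ hg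
  have hpow : ∀ a : ℝ≥0∞, a ^ p = ENNReal.ofReal p * ∫⁻ t in Set.Ioi (0 : ℝ),
      (if ENNReal.ofReal t < a then ENNReal.ofReal (t ^ (p - 1)) else 0) := by
    intro a
    rw [lintegral_Ioi_rpow_lt hp0, ENNReal.mul_div_cancel (by simpa using hp0) (by simp)]
  have hmeas : ∀ {G : (Fin n → ℝ) → ℝ≥0∞} (_ : Measurable G) (s : ℝ), Measurable
      (Function.uncurry fun x t => if ENNReal.ofReal t < G x then
        ENNReal.ofReal (t ^ (s - 1)) else 0) := by
    intro G hG s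
    exact Measurable.ite (measurableSet_lt (by fun_prop) (by fun_prop)) (by fun_prop) (by fun_prop)
  have hweak : ∀ t ∈ Set.Ioi (0 : ℝ), μ {x | ENNReal.ofReal t < dyadicMax μ g x} ≤
      2 * N * ((ENNReal.ofReal t)⁻¹ * ∫⁻ x, (if ENNReal.ofReal t < 2 * g x then g x else 0) ∂μ) := by
    intro t ht
    have h0 : ENNReal.ofReal t ≠ 0 := by simpa using ht
    have hsub : {x | ENNReal.ofReal t < dyadicMax μ g x} ⊆ {x | ENNReal.ofReal t / 2 <
        dyadicMax μ (fun y => if ENNReal.ofReal t < 2 * g y then g y else 0) x} := by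
      intro x hx
      by_contra hcon
      simp only [Set.mem_ofPred_eq, not_lt] at hx hcon
      have := dyadicMax_le_truncation μ (g := g) (ENNReal.ofReal t) x
      refine absurd (hx.trans_le this) (not_lt.2 ?_)
      calc _ ≤ ENNReal.ofReal t / 2 + ENNReal.ofReal t / 2 := by gcongr
        _ = _ := ENNReal.add_halves _
    have h1 := hN μ (fun y => if ENNReal.ofReal t < 2 * g y then g y else 0) (ENNReal.ofReal t / 2)
    refine (measure_mono hsub).trans ?_
    have h2 : ENNReal.ofReal t / 2 ≠ 0 := by simpa using ht
    have h3 : ENNReal.ofReal t / 2 ≠ ⊤ := ENNReal.div_ne_top (by simp) (by simp)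
    rw [mul_comm, ← ENNReal.le_div_iff_mul_le (Or.inl h2) (Or.inl h3)] at h1
    refine h1.trans_eq ?_
    rw [div_eq_mul_inv, ENNReal.inv_div (by simp) (by simp), div_eq_mul_inv]
    ring
  calc ∫⁻ x, dyadicMax μ g x ^ p ∂μ
      = ENNReal.ofReal p * ∫⁻ x, (∫⁻ t in Set.Ioi (0 : ℝ),
        (if ENNReal.ofReal t < dyadicMax μ g x then ENNReal.ofReal (t ^ (p - 1)) else 0)) ∂μ := by
        rw [← lintegral_const_mul' _ _ ENNReal.ofReal_ne_top]
        exact lintegral_congr fun x => hpow _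
    _ = ENNReal.ofReal p * ∫⁻ t in Set.Ioi (0 : ℝ), ∫⁻ x,
        (if ENNReal.ofReal t < dyadicMax μ g x then ENNReal.ofReal (t ^ (p - 1)) else 0) ∂μ := by
        rw [lintegral_lintegral_swap (hmeas hM p).aemeasurable]
    _ = ENNReal.ofReal p * ∫⁻ t in Set.Ioi (0 : ℝ),
        ENNReal.ofReal (t ^ (p - 1)) * μ {x | ENNReal.ofReal t < dyadicMax μ g x} := by
        congr 1
        refine lintegral_congr fun t => ?_
        rw [← lintegral_indicator_const (measurableSet_lt measurable_const hM)]
        refine lintegral_congr fun x => ?_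
        simp only [Set.indicator_apply, Set.mem_ofPred_eq]
    _ ≤ ENNReal.ofReal p * ∫⁻ t in Set.Ioi (0 : ℝ), 2 * N * ∫⁻ x, g x *
        (if ENNReal.ofReal t < 2 * g x then ENNReal.ofReal (t ^ (p - 1 - 1)) else 0) ∂μ := by
        gcongr ENNReal.ofReal p * ?_
        refine setLIntegral_mono' measurableSet_Ioi fun t ht => ?_
        refine (mul_le_mul_right (hweak t ht) _).trans_eq ?_
        have hc : ENNReal.ofReal (t ^ (p - 1)) * (ENNReal.ofReal t)⁻¹ =
            ENNReal.ofReal (t ^ (p - 1 - 1)) := by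
          rw [Real.rpow_sub_one (ne_of_gt ht) (p - 1), ENNReal.ofReal_div_of_pos ht, div_eq_mul_inv]
        rw [mul_left_comm, ← mul_assoc (ENNReal.ofReal (t ^ (p - 1))), hc,
          ← lintegral_const_mul' _ _ ENNReal.ofReal_ne_top]
        congr 1
        refine lintegral_congr fun x => ?_
        split_ifs
        · exact mul_comm _ _
        · simp
    _ = ENNReal.ofReal p * (2 * N) * ∫⁻ x, (∫⁻ t in Set.Ioi (0 : ℝ), g x *
        (if ENNReal.ofReal t < 2 * g x then ENNReal.ofReal (t ^ (p - 1 - 1)) else 0)) ∂μ := by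
        rw [lintegral_const_mul' _ _ (ENNReal.mul_ne_top (by simp) (by simp)), ← mul_assoc]
        congr 1
        refine (lintegral_lintegral_swap ?_).symm
        exact ((hg.comp measurable_fst).mul
          (hmeas (hg.const_mul 2) (p - 1))).aemeasurable
    _ = ENNReal.ofReal p * (2 * N) * ∫⁻ x,
        (2 ^ (p - 1) / ENNReal.ofReal (p - 1)) * g x ^ p ∂μ := by
        congr 1
        refine lintegral_congr fun x => ?_
        rw [lintegral_const_mul _ (by
          exact Measurable.ite (measurableSet_lt (by fun_prop) (by fun_prop)) (by fun_prop)
            (by fun_prop)), lintegral_Ioi_rpow_lt hp1, ENNReal.mul_rpow_of_nonneg _ _ hp1.le]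
        have : g x ^ p = g x * g x ^ (p - 1) := by
          conv_rhs => rw [← ENNReal.rpow_one (g x), ← ENNReal.rpow_mul, one_mul]
          rw [← ENNReal.rpow_add_of_nonneg _ _ zero_le_one hp1.le]
          congr 1
          ring
        rw [this, div_eq_mul_inv, div_eq_mul_inv]
        ring
    _ = _ := by
        rw [lintegral_const_mul _ (hg.pow_const p)]
        ring

lemma volume_closedBall_ne_zero {n : ℕ} (x : Fin n → ℝ) {r : ℝ} (hr : 0 < r) :
    volume (Metric.closedBall x r) ≠ 0 :=
  (Metric.measure_closedBall_pos volume x hr).ne'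

lemma volume_closedBall_ne_top {n : ℕ} (x : Fin n → ℝ) (r : ℝ) :
    volume (Metric.closedBall x r) ≠ ⊤ :=
  measure_closedBall_lt_top.ne

lemma volume_closedBall_four_mul {n : ℕ} (x y : Fin n → ℝ) {r : ℝ} (hr : 0 ≤ r) :
    volume (Metric.closedBall x (4 * r)) = 4 ^ n * volume (Metric.closedBall y r) := by
  rw [Real.volume_pi_closedBall _ hr, Real.volume_pi_closedBall _ (by positivity), Fintype.card_fin,
    show 2 * (4 * r) = 4 * (2 * r) by ring, mul_pow, ENNReal.ofReal_mul (by positivity)]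
  congr 1
  rw [ENNReal.ofReal_pow (by norm_num)]
  norm_num

lemma setLIntegral_closedBall_ne_zero {n : ℕ} {W : (Fin n → ℝ) → ℝ≥0∞} (hW : Measurable W)
    (hpos : ∀ᵐ x, W x ≠ 0) (x : Fin n → ℝ) {r : ℝ} (hr : 0 < r) :
    ∫⁻ y in Metric.closedBall x r, W y ≠ 0 := by
  intro h
  rw [lintegral_eq_zero_iff hW] at h
  have h2 : ∀ᵐ y ∂(volume.restrict (Metric.closedBall x r)), False := by
    filter_upwards [h, ae_restrict_of_ae hpos] with y h1 h2 using h2 h1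
  rw [Filter.eventually_false_iff_eq_bot, ae_eq_bot, Measure.restrict_eq_zero] at h2
  exact volume_closedBall_ne_zero x hr h2

/-- Lerner's pointwise bound: for an `A_p` pair `(W, S)` the maximal function is controlled by
a composition of the centered maximal functions with respect to `W` and `S`. -/
lemma dyadicMax_rpow_le {n : ℕ} {p : ℝ} (hp : 1 < p) {W S : (Fin n → ℝ) → ℝ≥0∞}
    (hWm : Measurable W) (hSm : Measurable S) (hW : ∀ᵐ x, W x ≠ 0 ∧ W x ≠ ⊤)
    (hS : ∀ᵐ x, S x ≠ 0 ∧ S x ≠ ⊤) {C : ℝ≥0∞} (hC : C ≠ ⊤)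
    (hA : ∀ x r, 0 < r → (∫⁻ y in Metric.closedBall x r, W y) *
      (∫⁻ y in Metric.closedBall x r, S y) ^ (p - 1) ≤ C * volume (Metric.closedBall x r) ^ p)
    {g : (Fin n → ℝ) → ℝ≥0∞} (hg : Measurable g) (x : Fin n → ℝ) :
    dyadicMax volume g x ^ (p - 1) ≤ C * (4 ^ n) ^ p * dyadicMax (volume.withDensity W)
      (fun y => dyadicMax (volume.withDensity S) (fun z => g z * (S z)⁻¹) y ^ (p - 1) *
        (W y)⁻¹) x := by
  have hp1 : 0 < p - 1 := by linarith
  have hm : Measurable fun z => g z * (S z)⁻¹ := hg.mul hSm.inv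
  have hmS := measurable_dyadicMax (volume.withDensity S) hm
  set MS := dyadicMax (volume.withDensity S) (fun z => g z * (S z)⁻¹) with hMS
  rw [← ENNReal.le_rpow_inv_iff hp1]
  refine iSup_le fun k => ?_
  rw [ENNReal.le_rpow_inv_iff hp1]
  have hr : (0 : ℝ) < 2 ^ k := by positivity
  set r : ℝ := 2 ^ k with hrk
  set B := Metric.closedBall x r with hB
  have hBm : MeasurableSet B := Metric.isClosed_closedBall.measurableSet
  set B4 := Metric.closedBall x (4 * r) with hB4
  have hBB4 : B ⊆ B4 := Metric.closedBall_subset_closedBall (by linarith)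
  set I := ∫⁻ y in B, g y with hI
  set a := ∫⁻ y in B4, S y with ha
  set b := ∫⁻ y in B4, W y with hb
  set v := volume B with hv
  set J := ∫⁻ y in B, MS y ^ (p - 1) with hJ
  have hv0 : v ≠ 0 := volume_closedBall_ne_zero x hr
  have hvt : v ≠ ⊤ := volume_closedBall_ne_top x r
  have ha0 : a ≠ 0 := setLIntegral_closedBall_ne_zero hSm (hS.mono fun _ h => h.1) x (by positivity)
  have hb0 : b ≠ 0 := setLIntegral_closedBall_ne_zero hWm (hW.mono fun _ h => h.1) x (by positivity)
  have hab : b * a ^ (p - 1) ≤ C * (4 ^ n * v) ^ p := by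
    have := hA x (4 * r) (by positivity)
    rwa [volume_closedBall_four_mul x x hr.le] at this
  have habt : b * a ^ (p - 1) ≠ ⊤ := ne_top_of_le_ne_top (ENNReal.mul_ne_top hC
    (ENNReal.rpow_ne_top_of_nonneg (by linarith) (ENNReal.mul_ne_top (by simp) hvt))) hab
  have hat : a ≠ ⊤ := by
    rintro h
    rw [h, ENNReal.top_rpow_of_pos hp1, ENNReal.mul_top hb0] at habt
    exact habt rfl
  have hbt : b ≠ ⊤ := by
    rintro h
    rw [h, ENNReal.top_mul (by simp [ENNReal.rpow_eq_zero_iff, ha0, hat])] at habt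
    exact habt rfl
  have hWB : (volume.withDensity W) B = ∫⁻ y in B, W y := withDensity_apply _ hBm
  have hIS : ∀ s, MeasurableSet s →
      ∫⁻ y in s, g y * (S y)⁻¹ ∂(volume.withDensity S) = ∫⁻ y in s, g y := by
    intro s hs
    rw [setLIntegral_withDensity_eq_setLIntegral_mul _ hSm hm hs]
    refine lintegral_congr_ae (ae_restrict_of_ae ?_)
    filter_upwards [hS] with y hy
    simp only [Pi.mul_apply]
    rw [mul_left_comm, ENNReal.mul_inv_cancel hy.1 hy.2, mul_one]
  have hpt : ∀ y ∈ B, a⁻¹ * I ≤ MS y := by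
    intro y hy
    have h1 : B ⊆ Metric.closedBall y ((2 : ℝ) ^ (k + 1)) := by
      refine Metric.closedBall_subset_closedBall' ?_
      rw [zpow_add_one₀ (by norm_num), ← hrk, dist_comm]
      linarith [Metric.mem_closedBall.1 hy]
    have h2 : Metric.closedBall y ((2 : ℝ) ^ (k + 1)) ⊆ B4 := by
      refine Metric.closedBall_subset_closedBall' ?_
      rw [zpow_add_one₀ (by norm_num), ← hrk]
      linarith [Metric.mem_closedBall.1 hy]
    refine le_trans ?_ (le_iSup (fun k : ℤ =>
      ((volume.withDensity S) (Metric.closedBall y ((2 : ℝ) ^ k)))⁻¹ *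
      ∫⁻ z in Metric.closedBall y ((2 : ℝ) ^ k), g z * (S z)⁻¹ ∂(volume.withDensity S)) (k + 1))
    rw [hIS _ Metric.isClosed_closedBall.measurableSet,
      withDensity_apply _ Metric.isClosed_closedBall.measurableSet]
    exact mul_le_mul' (ENNReal.inv_le_inv.2 (lintegral_mono_set h2)) (lintegral_mono_set h1)
  have hvJ : v * (a⁻¹ * I) ^ (p - 1) ≤ J := by
    rw [mul_comm, ← setLIntegral_const]
    exact setLIntegral_mono' hBm fun y hy => ENNReal.rpow_le_rpow (hpt y hy) hp1.le
  have hmH : Measurable fun y => MS y ^ (p - 1) * (W y)⁻¹ := (hmS.pow_const _).mul hWm.inv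
  have hJW : J = ∫⁻ y in B, MS y ^ (p - 1) * (W y)⁻¹ ∂(volume.withDensity W) := by
    rw [setLIntegral_withDensity_eq_setLIntegral_mul _ hWm hmH hBm]
    refine lintegral_congr_ae (ae_restrict_of_ae ?_)
    filter_upwards [hW] with y hy
    simp only [Pi.mul_apply]
    rw [mul_left_comm, ENNReal.mul_inv_cancel hy.1 hy.2, mul_one]
  have hvp0 : v ^ (p - 1) ≠ 0 := by simp [ENNReal.rpow_eq_zero_iff, hv0, hvt]
  have hvpt : v ^ (p - 1) ≠ ⊤ := ENNReal.rpow_ne_top_of_nonneg hp1.le hvt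
  have hvp : v ^ p = v ^ (p - 1) * v := by
    conv_rhs => rw [← ENNReal.rpow_one v, ← ENNReal.rpow_mul, one_mul]
    rw [← ENNReal.rpow_add _ _ hv0 hvt, sub_add_cancel]
  have hvp0' : v ^ p ≠ 0 := by rw [hvp]; exact mul_ne_zero hvp0 hv0
  have hvpt' : v ^ p ≠ ⊤ := by rw [hvp]; exact ENNReal.mul_ne_top hvpt hvt
  calc (v⁻¹ * I) ^ (p - 1)
      = (v ^ p)⁻¹ * (a ^ (p - 1) * (v * (a⁻¹ * I) ^ (p - 1))) := by
        rw [ENNReal.mul_rpow_of_nonneg _ _ hp1.le, ENNReal.mul_rpow_of_nonneg _ _ hp1.le,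
          ENNReal.inv_rpow, ENNReal.inv_rpow, hvp,
          ENNReal.mul_inv (Or.inl hvp0) (Or.inl hvpt)]
        have e1 : a ^ (p - 1) * (a ^ (p - 1))⁻¹ = 1 := ENNReal.mul_inv_cancel
          (by simp [ENNReal.rpow_eq_zero_iff, ha0, hat]) (ENNReal.rpow_ne_top_of_nonneg hp1.le hat)
        have e2 : v⁻¹ * v = 1 := ENNReal.inv_mul_cancel hv0 hvt
        calc _ = (v ^ (p - 1))⁻¹ * I ^ (p - 1) * (v⁻¹ * v) * (a ^ (p - 1) * (a ^ (p - 1))⁻¹) := by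
              rw [e1, e2, mul_one, mul_one]
          _ = _ := by ring
    _ ≤ (v ^ p)⁻¹ * (a ^ (p - 1) * J) := by gcongr
    _ = (v ^ p)⁻¹ * (b * a ^ (p - 1)) * (b⁻¹ * J) := by
        calc _ = (v ^ p)⁻¹ * (a ^ (p - 1) * J) * (b * b⁻¹) := by
              rw [ENNReal.mul_inv_cancel hb0 hbt, mul_one]
          _ = _ := by ring
    _ ≤ (v ^ p)⁻¹ * (C * (4 ^ n * v) ^ p) * ((∫⁻ y in B, W y)⁻¹ * J) := by
        gcongr
        exact lintegral_mono_set hBB4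
    _ = C * (4 ^ n) ^ p * ((∫⁻ y in B, W y)⁻¹ * J) := by
        rw [ENNReal.mul_rpow_of_nonneg _ _ (by linarith : 0 ≤ p)]
        calc _ = C * (4 ^ n) ^ p * ((∫⁻ y in B, W y)⁻¹ * J) * ((v ^ p)⁻¹ * v ^ p) := by ring
          _ = _ := by rw [ENNReal.inv_mul_cancel hvp0' hvpt', mul_one]
    _ ≤ _ := by
        gcongr
        rw [hJW, ← hWB]
        exact le_iSup (fun k : ℤ =>
          ((volume.withDensity W) (Metric.closedBall x ((2 : ℝ) ^ k)))⁻¹ *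
          ∫⁻ y in Metric.closedBall x ((2 : ℝ) ^ k),
            MS y ^ (p - 1) * (W y)⁻¹ ∂(volume.withDensity W)) k

/-- Muckenhoupt's theorem for the maximal function over dyadic radii. -/
lemma exists_weighted_bound_dyadicMax {n : ℕ} {p q : ℝ} (hpq : p.HolderConjugate q)
    {W S : (Fin n → ℝ) → ℝ≥0∞} (hWm : Measurable W) (hSm : Measurable S)
    (hW : ∀ᵐ x, W x ≠ 0 ∧ W x ≠ ⊤) (hS : ∀ᵐ x, S x = W x ^ (1 - q)) {C : ℝ≥0∞} (hC : C ≠ ⊤)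
    (hA : ∀ x r, 0 < r → (∫⁻ y in Metric.closedBall x r, W y) *
      (∫⁻ y in Metric.closedBall x r, S y) ^ (p - 1) ≤ C * volume (Metric.closedBall x r) ^ p) :
    ∃ K : ℝ≥0∞, K ≠ ⊤ ∧ ∀ g : (Fin n → ℝ) → ℝ≥0∞, Measurable g →
      ∫⁻ x, dyadicMax volume g x ^ p * W x ≤ K * ∫⁻ x, g x ^ p * W x := by
  have hp := hpq.lt
  have hq := hpq.symm.lt
  have hp1 : 0 < p - 1 := by linarith
  have hmul : (p - 1) * q = p := hpq.sub_one_mul_conj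
  have hS' : ∀ᵐ x, S x ≠ 0 ∧ S x ≠ ⊤ := by
    filter_upwards [hW, hS] with x h1 h2
    rw [h2]
    exact ⟨by simp [ENNReal.rpow_eq_zero_iff, h1.1, h1.2],
      by simp [ENNReal.rpow_eq_top_iff, h1.1, h1.2]⟩
  obtain ⟨K₁, hK₁, h₁⟩ := exists_strong_type_dyadicMax n hp
  obtain ⟨K₂, hK₂, h₂⟩ := exists_strong_type_dyadicMax n hq
  refine ⟨(C * (4 ^ n) ^ p) ^ q * (K₂ * K₁), ?_, fun g hg => ?_⟩
  · refine ENNReal.mul_ne_top (ENNReal.rpow_ne_top_of_nonneg (by linarith)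
      (ENNReal.mul_ne_top hC (ENNReal.rpow_ne_top_of_nonneg (by linarith) (by simp))))
      (ENNReal.mul_ne_top hK₂ hK₁)
  have hm : Measurable fun z => g z * (S z)⁻¹ := hg.mul hSm.inv
  have hmS := measurable_dyadicMax (volume.withDensity S) hm
  have hH : Measurable fun x => dyadicMax (volume.withDensity S) (fun z => g z * (S z)⁻¹) x ^ (p - 1) *
      (W x)⁻¹ := (hmS.pow_const (p - 1)).mul hWm.inv
  have hmW := measurable_dyadicMax (volume.withDensity W) hH
  have key := h₁ (volume.withDensity S) _ hm
  have key₂ := h₂ (volume.withDensity W) _ hH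
  have hpt := dyadicMax_rpow_le hp hWm hSm hW hS' hC hA hg
  rw [lintegral_withDensity_eq_lintegral_mul _ hSm (hmS.pow_const p),
    lintegral_withDensity_eq_lintegral_mul _ hSm (hm.pow_const p)] at key
  rw [lintegral_withDensity_eq_lintegral_mul _ hWm (hmW.pow_const q),
    lintegral_withDensity_eq_lintegral_mul _ hWm (hH.pow_const q)] at key₂
  calc ∫⁻ x, dyadicMax volume g x ^ p * W x
      ≤ ∫⁻ x, (C * (4 ^ n) ^ p) ^ q * (W x * dyadicMax (volume.withDensity W)
      (fun y => dyadicMax (volume.withDensity S) (fun z => g z * (S z)⁻¹) y ^ (p - 1) *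
        (W y)⁻¹) x ^ q) := by
        refine lintegral_mono fun x => ?_
        have := ENNReal.rpow_le_rpow (hpt x) (by linarith : 0 ≤ q)
        rw [← ENNReal.rpow_mul, hmul, ENNReal.mul_rpow_of_nonneg _ _ (by linarith)] at this
        rw [mul_comm, mul_left_comm]
        gcongr
    _ = (C * (4 ^ n) ^ p) ^ q * ∫⁻ x, (W x * dyadicMax (volume.withDensity W)
      (fun y => dyadicMax (volume.withDensity S) (fun z => g z * (S z)⁻¹) y ^ (p - 1) *
        (W y)⁻¹) x ^ q) := lintegral_const_mul _ (hWm.mul (hmW.pow_const q))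
    _ ≤ (C * (4 ^ n) ^ p) ^ q * (K₂ * ∫⁻ x, W x * (dyadicMax (volume.withDensity S)
      (fun z => g z * (S z)⁻¹) x ^ (p - 1) * (W x)⁻¹) ^ q) := mul_le_mul_right key₂ _
    _ = (C * (4 ^ n) ^ p) ^ q * (K₂ * ∫⁻ x, S x * (dyadicMax (volume.withDensity S)
      (fun z => g z * (S z)⁻¹) x ^ p)) := by
        congr 2
        refine lintegral_congr_ae ?_
        filter_upwards [hW, hS] with x h1 h2
        rw [ENNReal.mul_rpow_of_nonneg _ _ (by linarith : 0 ≤ q), ← ENNReal.rpow_mul, hmul,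
          mul_left_comm, h2, mul_comm, sub_eq_add_neg, ENNReal.rpow_add _ _ h1.1 h1.2,
          ENNReal.rpow_one, ENNReal.inv_rpow, ENNReal.rpow_neg]
    _ ≤ (C * (4 ^ n) ^ p) ^ q * (K₂ * (K₁ * ∫⁻ x, S x * (g x * (S x)⁻¹) ^ p)) := by
        gcongr _ * (_ * ?_)
        exact key
    _ = (C * (4 ^ n) ^ p) ^ q * (K₂ * (K₁ * ∫⁻ x, g x ^ p * W x)) := by
        congr 3
        refine lintegral_congr_ae ?_
        filter_upwards [hW, hS, hS'] with x h1 h2 h3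
        rw [ENNReal.mul_rpow_of_nonneg _ _ (by linarith : 0 ≤ p), mul_left_comm, ENNReal.inv_rpow,
          ← ENNReal.rpow_neg]
        congr 1
        nth_rewrite 1 [← ENNReal.rpow_one (S x)]
        rw [← ENNReal.rpow_add _ _ h3.1 h3.2, h2, ← ENNReal.rpow_mul,
          show (1 - q) * (1 + -p) = 1 by linarith [hpq.mul_eq_add], ENNReal.rpow_one]
    _ = _ := by ring

lemma isCube_iff_closedBall {n : ℕ} {Q : Set (Fin n → ℝ)} :
    IsCube Q ↔ ∃ c r, 0 < r ∧ Q = Metric.closedBall c r := by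
  constructor
  · rintro ⟨a, l, hl, rfl⟩
    refine ⟨fun i => a i + l / 2, l / 2, by positivity, ?_⟩
    rw [closedBall_pi _ (by positivity)]
    refine Set.pi_congr rfl fun i _ => ?_
    rw [Real.closedBall_eq_Icc]
    congr 1 <;> ring
  · rintro ⟨c, r, hr, rfl⟩
    refine ⟨fun i => c i - r, 2 * r, by positivity, ?_⟩
    rw [closedBall_pi _ hr.le]
    refine Set.pi_congr rfl fun i _ => ?_
    rw [Real.closedBall_eq_Icc]
    congr 1
    ring

lemma maximal_univ_le_dyadicMax {n : ℕ} (f : (Fin n → ℝ) → ℝ) (x : Fin n → ℝ) :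
    maximal Set.univ f x ≤ 4 ^ n * dyadicMax volume (fun y => ENNReal.ofReal |f y|) x := by
  refine iSup₂_le fun Q hQ => iSup₂_le fun _ hx => ?_
  obtain ⟨c, r, hr, rfl⟩ := isCube_iff_closedBall.1 hQ
  obtain ⟨k, hk⟩ := exists_mem_Ioc_zpow (x := 2 * r) (y := (2 : ℝ)) (by positivity) (by norm_num)
  have hsub : Metric.closedBall c r ⊆ Metric.closedBall x ((2 : ℝ) ^ (k + 1)) := by
    refine Metric.closedBall_subset_closedBall' ?_
    have := Metric.mem_closedBall.1 hx
    rw [dist_comm] at this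
    linarith [hk.2]
  have hvol : volume (Metric.closedBall x ((2 : ℝ) ^ (k + 1))) ≤
      4 ^ n * volume (Metric.closedBall c r) := by
    rw [← volume_closedBall_four_mul x c hr.le]
    refine measure_mono (Metric.closedBall_subset_closedBall ?_)
    rw [zpow_add_one₀ (by norm_num)]
    linarith [hk.1]
  have h4 : ((4 : ℝ≥0∞) ^ n) ≠ 0 := by simp
  have h4t : ((4 : ℝ≥0∞) ^ n) ≠ ⊤ := by simp
  calc (volume (Metric.closedBall c r))⁻¹ * ∫⁻ y in Metric.closedBall c r, ENNReal.ofReal |f y|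
      = 4 ^ n * ((4 ^ n * volume (Metric.closedBall c r))⁻¹ *
        ∫⁻ y in Metric.closedBall c r, ENNReal.ofReal |f y|) := by
        rw [ENNReal.mul_inv (Or.inl h4) (Or.inl h4t), ← mul_assoc, ← mul_assoc,
          ENNReal.mul_inv_cancel h4 h4t, one_mul]
    _ ≤ 4 ^ n * ((volume (Metric.closedBall x ((2 : ℝ) ^ (k + 1))))⁻¹ *
        ∫⁻ y in Metric.closedBall x ((2 : ℝ) ^ (k + 1)), ENNReal.ofReal |f y|) := by
        gcongr
    _ ≤ _ := by
        gcongr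
        exact le_iSup (fun k : ℤ => (volume (Metric.closedBall x ((2 : ℝ) ^ k)))⁻¹ *
          ∫⁻ y in Metric.closedBall x ((2 : ℝ) ^ k), ENNReal.ofReal |f y|) (k + 1)

lemma memA1_of_dyadicMax_le {n : ℕ} {R : (Fin n → ℝ) → ℝ≥0∞} (hR : Measurable R)
    (hR0 : ∀ᵐ x, R x ≠ 0 ∧ R x ≠ ⊤) {K : ℝ≥0∞} (hK : K ≠ ⊤)
    (hM : ∀ x, dyadicMax volume R x ≤ K * R x) : MemA Set.univ 1 (fun x => (R x).toReal) := by
  have hae : ∀ᵐ x, ENNReal.ofReal |(R x).toReal| = R x := by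
    filter_upwards [hR0] with x hx
    rw [abs_of_nonneg ENNReal.toReal_nonneg, ENNReal.ofReal_toReal hx.2]
  have hmax : ∀ x, maximal Set.univ (fun x => (R x).toReal) x ≤ 4 ^ n * K * R x := by
    intro x
    refine (maximal_univ_le_dyadicMax _ x).trans ?_
    rw [mul_assoc]
    refine mul_le_mul_right ((le_of_eq ?_).trans (hM x)) _
    refine iSup_congr fun k => ?_
    rw [lintegral_congr_ae (ae_restrict_of_ae hae)]
  have hCt : 4 ^ n * K ≠ ⊤ := ENNReal.mul_ne_top (by simp) hK
  refine Or.inl ⟨rfl, ⟨hR.ennreal_toReal, ?_, ?_⟩, (4 ^ n * K).toReal, ?_⟩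
  · rw [Measure.restrict_univ]
    filter_upwards [hR0] with x hx using ENNReal.toReal_pos hx.1 hx.2
  · intro Q hQ _
    refine ⟨hR.ennreal_toReal.aestronglyMeasurable, ?_⟩
    obtain ⟨c, r, hr, rfl⟩ := isCube_iff_closedBall.1 hQ
    have hne : Filter.NeBot (ae (volume.restrict (Metric.closedBall c r))) := by
      rw [ae_neBot, Ne, Measure.restrict_eq_zero]
      exact volume_closedBall_ne_zero c hr
    obtain ⟨x, hx, hxQ⟩ := ((ae_restrict_of_ae (s := Metric.closedBall c r) hR0).and
      (ae_restrict_mem Metric.isClosed_closedBall.measurableSet)).exists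
    have h1 : (volume (Metric.closedBall c r))⁻¹ *
        ∫⁻ y in Metric.closedBall c r, ENNReal.ofReal |(R y).toReal| ≤ 4 ^ n * K * R x := by
      refine le_trans ?_ (hmax x)
      exact le_iSup₂_of_le (Metric.closedBall c r) hQ
        (le_iSup₂_of_le (Set.subset_univ _) hxQ le_rfl)
    have h2 := ne_top_of_le_ne_top (ENNReal.mul_ne_top hCt hx.2) h1
    simp only [HasFiniteIntegral, Real.enorm_eq_ofReal_abs]
    rw [lt_top_iff_ne_top]
    intro h
    rw [h, ENNReal.mul_top (ENNReal.inv_ne_zero.2 (volume_closedBall_ne_top c r))] at h2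
    exact h2 rfl
  · rw [Measure.restrict_univ]
    filter_upwards [hR0] with x hx
    rw [ENNReal.ofReal_mul ENNReal.toReal_nonneg, ENNReal.ofReal_toReal hCt,
      ENNReal.ofReal_toReal hx.2]
    exact hmax x

lemma dyadicMax_tsum_le {n : ℕ} (μ : Measure (Fin n → ℝ)) {A : ℕ → (Fin n → ℝ) → ℝ≥0∞}
    (hA : ∀ j, Measurable (A j)) (c : ℕ → ℝ≥0∞) (x : Fin n → ℝ) :
    dyadicMax μ (fun y => ∑' j, c j * A j y) x ≤ ∑' j, c j * dyadicMax μ (A j) x := by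
  refine iSup_le fun k => ?_
  rw [lintegral_tsum fun j => ((hA j).const_mul _).aemeasurable, ← ENNReal.tsum_mul_left]
  refine ENNReal.tsum_le_tsum fun j => ?_
  rw [lintegral_const_mul _ (hA j), mul_left_comm]
  gcongr
  exact le_iSup (fun k : ℤ => (μ (Metric.closedBall x ((2 : ℝ) ^ k)))⁻¹ *
    ∫⁻ y in Metric.closedBall x ((2 : ℝ) ^ k), A j y ∂μ) k

/-- The Rubio de Francia algorithm. -/
lemma exists_memA1_majorant {n : ℕ} {p : ℝ} (hp : 1 < p) {W : (Fin n → ℝ) → ℝ≥0∞}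
    (hWm : Measurable W) (hW : ∀ᵐ x, W x ≠ 0 ∧ W x ≠ ⊤) {K : ℝ≥0∞} (hK : K ≠ ⊤)
    (hM : ∀ g : (Fin n → ℝ) → ℝ≥0∞, Measurable g →
      ∫⁻ x, dyadicMax volume g x ^ p * W x ≤ K * ∫⁻ x, g x ^ p * W x)
    {f : (Fin n → ℝ) → ℝ≥0∞} (hf : Measurable f) (hfp : ∫⁻ x, f x ^ p * W x < ⊤) :
    ∃ u : (Fin n → ℝ) → ℝ, MemA Set.univ 1 u ∧ (∀ᵐ x, f x ≤ ENNReal.ofReal (u x)) ∧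
      ∫⁻ x, ENNReal.ofReal (u x) ^ p * W x < ⊤ := by
  have hp0 : 0 < p := by linarith
  obtain ⟨ψ, hψ0, hψm, hψ⟩ := exists_pos_lintegral_lt_of_sigmaFinite
    (volume : Measure (Fin n → ℝ)) one_ne_zero
  set φ : (Fin n → ℝ) → ℝ≥0∞ := fun x => (ψ x * (W x)⁻¹) ^ p⁻¹ with hφ
  have hφm : Measurable φ := (hψm.coe_nnreal_ennreal.mul hWm.inv).pow_const _
  have hφp : ∫⁻ x, φ x ^ p * W x < ⊤ := by
    refine lt_of_le_of_lt (le_of_eq (lintegral_congr_ae ?_)) (hψ.trans one_lt_top)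
    filter_upwards [hW] with x hx
    rw [hφ, ENNReal.rpow_inv_rpow hp0.ne', mul_assoc, ENNReal.inv_mul_cancel hx.1 hx.2, mul_one]
  set G : (Fin n → ℝ) → ℝ≥0∞ := fun x => max (f x) (φ x) with hG
  have hGm : Measurable G := hf.max hφm
  set F := ∫⁻ x, G x ^ p * W x with hF
  have hFt : F ≠ ⊤ := by
    refine ne_top_of_le_ne_top (ENNReal.add_ne_top.2 ⟨hfp.ne, hφp.ne⟩) ?_
    have hfW : Measurable fun x => f x ^ p * W x := (hf.pow_const p).mul hWm
    rw [← lintegral_add_left hfW]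
    refine lintegral_mono fun x => ?_
    rcases le_total (f x) (φ x) with h | h
    · simp only [hG, max_eq_right h]
      exact le_add_self
    · simp only [hG, max_eq_left h]
      exact le_self_add
  set A : ℕ → (Fin n → ℝ) → ℝ≥0∞ := fun k => (dyadicMax volume)^[k] G with hA
  have hAs : ∀ k, A (k + 1) = dyadicMax volume (A k) := fun k =>
    Function.iterate_succ_apply' _ _ _
  have hAm : ∀ k, Measurable (A k) := by
    intro k
    induction k with
    | zero => exact hGm
    | succ k ih => rw [hAs]; exact measurable_dyadicMax _ ih
  have hAp : ∀ k, ∫⁻ x, A k x ^ p * W x ≤ K ^ k * F := by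
    intro k
    induction k with
    | zero => simp [hA, hF]
    | succ k ih =>
      rw [hAs, pow_succ', mul_assoc]
      exact (hM _ (hAm k)).trans (by gcongr)
  set B : ℝ≥0∞ := 1 + K with hB
  have hBt : B ≠ ⊤ := by simp [hB, hK]
  have hB0 : B ≠ 0 := by simp [hB]
  set ρ : ℝ≥0∞ := (2 * B)⁻¹ with hρ
  have h2B : 2 * K ≤ (2 * B) ^ p := by
    calc 2 * K ≤ 2 * B := by gcongr; exact le_add_self
      _ = (2 * B) ^ (1 : ℝ) := (ENNReal.rpow_one _).symm
      _ ≤ (2 * B) ^ p := by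
        refine ENNReal.rpow_le_rpow_of_exponent_le ?_ hp.le
        calc (1 : ℝ≥0∞) ≤ 1 * 1 := by simp
          _ ≤ 2 * B := mul_le_mul' (by norm_num) le_self_add
  have hρK : ρ ^ p * K ≤ 2⁻¹ := by
    rw [hρ, ENNReal.inv_rpow, mul_comm, ← div_eq_mul_inv]
    refine ENNReal.div_le_of_le_mul ?_
    calc K = 2⁻¹ * (2 * K) := by
          rw [← mul_assoc, ENNReal.inv_mul_cancel (by simp) (by simp), one_mul]
      _ ≤ _ := by gcongr
  have hc : (2⁻¹ * ρ) * (4 * B) = 1 := by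
    calc (2⁻¹ * ρ) * (4 * B) = (2⁻¹ * 2) * ((2 * B)⁻¹ * (2 * B)) := by rw [hρ]; ring
      _ = 1 := by
        rw [ENNReal.inv_mul_cancel (by simp) (by simp), one_mul, ENNReal.inv_mul_cancel
          (mul_ne_zero (by simp) hB0) (ENNReal.mul_ne_top (by simp) hBt)]
  set R : (Fin n → ℝ) → ℝ≥0∞ := fun x => ∑' k, (2⁻¹ * ρ) ^ k * A k x with hR
  have hRm : Measurable R := Measurable.tsum fun k => (hAm k).const_mul _
  have hGR : ∀ x, G x ≤ R x := by
    intro x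
    refine le_trans ?_ (ENNReal.le_tsum 0)
    simp [hA]
  have hDR : ∀ x, dyadicMax volume R x ≤ 4 * B * R x := by
    intro x
    refine (dyadicMax_tsum_le _ hAm _ x).trans ?_
    calc ∑' j, (2⁻¹ * ρ) ^ j * dyadicMax volume (A j) x
        = ∑' j, 4 * B * ((2⁻¹ * ρ) ^ (j + 1) * A (j + 1) x) := by
          refine tsum_congr fun j => ?_
          rw [hAs, pow_succ]
          calc _ = (2⁻¹ * ρ) ^ j * dyadicMax volume (A j) x * 1 := (mul_one _).symm
            _ = (2⁻¹ * ρ) ^ j * dyadicMax volume (A j) x * ((2⁻¹ * ρ) * (4 * B)) := by rw [hc]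
            _ = _ := by ring
      _ = 4 * B * ∑' j, ((2⁻¹ * ρ) ^ (j + 1) * A (j + 1) x) := ENNReal.tsum_mul_left
      _ ≤ 4 * B * R x := by
          gcongr
          exact ENNReal.tsum_comp_le_tsum_of_injective (add_left_injective 1)
            (fun j => (2⁻¹ * ρ) ^ j * A j x)
  have hRpt : ∀ x, R x ^ p ≤ 2 ^ p * ∑' k, (ρ ^ p) ^ k * A k x ^ p := by
    intro x
    set s := ∑' k, (ρ ^ p) ^ k * A k x ^ p with hs
    have h1 : R x ≤ 2 * s ^ p⁻¹ := by
      calc R x ≤ ∑' k : ℕ, 2⁻¹ ^ k * s ^ p⁻¹ := by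
            refine ENNReal.tsum_le_tsum fun k => ?_
            rw [mul_pow, mul_assoc]
            gcongr
            rw [ENNReal.le_rpow_inv_iff hp0]
            refine le_trans (le_of_eq ?_) (ENNReal.le_tsum k)
            rw [ENNReal.mul_rpow_of_nonneg _ _ hp0.le, ← ENNReal.rpow_natCast,
              ← ENNReal.rpow_natCast, ← ENNReal.rpow_mul, ← ENNReal.rpow_mul, mul_comm p]
        _ = 2 * s ^ p⁻¹ := by
            rw [ENNReal.tsum_mul_right, ENNReal.tsum_geometric, ENNReal.one_sub_inv_two, inv_inv]
    calc R x ^ p ≤ (2 * s ^ p⁻¹) ^ p := ENNReal.rpow_le_rpow h1 hp0.le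
      _ = _ := by rw [ENNReal.mul_rpow_of_nonneg _ _ hp0.le, ENNReal.rpow_inv_rpow hp0.ne']
  have hRp : ∫⁻ x, R x ^ p * W x < ⊤ := by
    calc ∫⁻ x, R x ^ p * W x
        ≤ ∫⁻ x, 2 ^ p * ∑' k, (ρ ^ p) ^ k * (A k x ^ p * W x) := by
          refine lintegral_mono fun x => ?_
          refine (mul_le_mul_left (hRpt x) _).trans_eq ?_
          rw [mul_assoc, ← ENNReal.tsum_mul_right]
          simp only [mul_assoc]
      _ = 2 ^ p * ∑' k, (ρ ^ p) ^ k * ∫⁻ x, A k x ^ p * W x := by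
          have hm : ∀ k, Measurable fun x => A k x ^ p * W x := fun k =>
            ((hAm k).pow_const p).mul hWm
          rw [lintegral_const_mul _ (Measurable.tsum fun k => (hm k).const_mul _),
            lintegral_tsum fun k => ((hm k).const_mul _).aemeasurable]
          congr 2
          ext k
          rw [lintegral_const_mul _ (hm k)]
      _ ≤ 2 ^ p * ∑' k : ℕ, 2⁻¹ ^ k * F := by
          refine mul_le_mul_right (ENNReal.tsum_le_tsum fun k => ?_) _
          calc (ρ ^ p) ^ k * ∫⁻ x, A k x ^ p * W x ≤ (ρ ^ p) ^ k * (K ^ k * F) := by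
                gcongr
                exact hAp k
            _ = (ρ ^ p * K) ^ k * F := by rw [mul_pow, mul_assoc]
            _ ≤ _ := by gcongr
      _ = 2 ^ p * (2 * F) := by
          rw [ENNReal.tsum_mul_right, ENNReal.tsum_geometric, ENNReal.one_sub_inv_two, inv_inv]
      _ < ⊤ := by
          refine (ENNReal.mul_ne_top (ENNReal.rpow_ne_top_of_nonneg hp0.le (by simp))
            (ENNReal.mul_ne_top (by simp) hFt)).lt_top
  have hR0 : ∀ᵐ x, R x ≠ 0 ∧ R x ≠ ⊤ := by
    filter_upwards [hW, ae_lt_top ((hRm.pow_const p).mul hWm) hRp.ne] with x h1 h2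
    constructor
    · have : 0 < φ x := by
        refine ENNReal.rpow_pos_of_nonneg ?_ (by positivity)
        exact ENNReal.mul_pos (by simpa using (hψ0 x).ne') (ENNReal.inv_ne_zero.2 h1.2)
      exact (this.trans_le ((le_max_right _ _).trans (hGR x))).ne'
    · intro h
      simp only [Pi.mul_apply] at h2
      rw [h, ENNReal.top_rpow_of_pos hp0, ENNReal.top_mul h1.1] at h2
      exact lt_irrefl _ h2
  have hRe : ∀ᵐ x, ENNReal.ofReal (R x).toReal = R x := by
    filter_upwards [hR0] with x hx using ENNReal.ofReal_toReal hx.2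
  refine ⟨fun x => (R x).toReal,
    memA1_of_dyadicMax_le hRm hR0 (ENNReal.mul_ne_top (by simp) hBt) hDR, ?_, ?_⟩
  · filter_upwards [hRe] with x hx
    rw [hx]
    exact (le_max_left _ _).trans (hGR x)
  · refine lt_of_le_of_lt (le_of_eq (lintegral_congr_ae ?_)) hRp
    filter_upwards [hRe] with x hx
    rw [hx]

lemma MemA.exists_average_le {n : ℕ} {w : (Fin n → ℝ) → ℝ} (hw : MemA Set.univ 1 w) :
    IsWeight Set.univ w ∧ ∃ c : ℝ≥0∞, c ≠ ⊤ ∧ ∀ Q : Set (Fin n → ℝ), IsCube Q →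
      ∀ᵐ x ∂(volume.restrict Q),
        (volume Q)⁻¹ * ∫⁻ y in Q, ENNReal.ofReal (w y) ≤ c * ENNReal.ofReal (w x) := by
  rcases hw with ⟨_, hw, C, hC⟩ | ⟨h, _⟩
  swap
  · exact absurd h (lt_irrefl _)
  refine ⟨hw, ENNReal.ofReal C, ENNReal.ofReal_ne_top, fun Q hQ => ?_⟩
  have hpos := hw.pos
  rw [Measure.restrict_univ] at hC hpos
  obtain ⟨c, r, hr, rfl⟩ := isCube_iff_closedBall.1 hQ
  filter_upwards [ae_restrict_of_ae hC, ae_restrict_of_ae hpos,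
    ae_restrict_mem Metric.isClosed_closedBall.measurableSet] with x h1 h2 h3
  rw [← ENNReal.ofReal_mul' h2.le]
  refine le_trans ?_ h1
  refine le_trans ?_ (le_iSup₂_of_le (Metric.closedBall c r) hQ
    (le_iSup₂_of_le (Set.subset_univ _) h3 le_rfl))
  gcongr
  exact le_abs_self _

lemma rpow_mul_average_le {n : ℕ} {V W : (Fin n → ℝ) → ℝ≥0∞} {Q : Set (Fin n → ℝ)} {m c : ℝ≥0∞}
    (hV : Measurable V) (hm : m ≠ ⊤) (hW : ∀ᵐ x, W x ≠ 0 ∧ W x ≠ ⊤)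
    (h : ∀ᵐ x ∂(volume.restrict Q), m ≤ c * W x) {s : ℝ} (hs : 0 ≤ s) :
    m ^ s * ((volume Q)⁻¹ * ∫⁻ x in Q, V x * W x ^ (-s)) ≤
      c ^ s * ((volume Q)⁻¹ * ∫⁻ x in Q, V x) := by
  rw [mul_left_comm, mul_left_comm (c ^ s),
    ← lintegral_const_mul' _ _ (ENNReal.rpow_ne_top_of_nonneg hs hm),
    ← lintegral_const_mul _ hV]
  refine mul_le_mul_right (lintegral_mono_ae ?_) _
  filter_upwards [h, ae_restrict_of_ae hW] with x h1 h2
  have h3 := ENNReal.rpow_le_rpow h1 hs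
  rw [ENNReal.mul_rpow_of_nonneg _ _ hs] at h3
  calc m ^ s * (V x * W x ^ (-s)) ≤ c ^ s * W x ^ s * (V x * W x ^ (-s)) := by gcongr
    _ = c ^ s * V x * (W x ^ s * W x ^ (-s)) := by ring
    _ = c ^ s * V x := by
      rw [← ENNReal.rpow_add _ _ h2.1 h2.2, add_neg_cancel, ENNReal.rpow_zero, mul_one]

lemma IsWeight.ofReal_ne {n : ℕ} {w : (Fin n → ℝ) → ℝ} (hw : IsWeight Set.univ w) :
    ∀ᵐ x, ENNReal.ofReal (w x) ≠ 0 ∧ ENNReal.ofReal (w x) ≠ ⊤ := by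
  have hpos := hw.pos
  rw [Measure.restrict_univ] at hpos
  filter_upwards [hpos] with x hx
  exact ⟨by simpa using hx, ENNReal.ofReal_ne_top⟩

lemma IsWeight.average_ne {n : ℕ} {w : (Fin n → ℝ) → ℝ} (hw : IsWeight Set.univ w)
    {Q : Set (Fin n → ℝ)} (hQ : IsCube Q) :
    (volume Q)⁻¹ * ∫⁻ y in Q, ENNReal.ofReal (w y) ≠ 0 ∧
      (volume Q)⁻¹ * ∫⁻ y in Q, ENNReal.ofReal (w y) ≠ ⊤ := by
  have hint := (hw.locInt Q hQ (Set.subset_univ _)).lintegral_lt_top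
  obtain ⟨c, r, hr, rfl⟩ := isCube_iff_closedBall.1 hQ
  refine ⟨mul_ne_zero (ENNReal.inv_ne_zero.2 (volume_closedBall_ne_top c r))
    (setLIntegral_closedBall_ne_zero hw.measurable.ennreal_ofReal
      (hw.ofReal_ne.mono fun _ h => h.1) c hr),
    ENNReal.mul_ne_top (ENNReal.inv_ne_top.2 (volume_closedBall_ne_zero c hr)) hint.ne⟩

/-- The elementary direction of the factorization of `A_p` weights. -/
lemma memA_mul_rpow {n : ℕ} {p : ℝ} (hp : 1 < p) {u w : (Fin n → ℝ) → ℝ}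
    (hu : MemA Set.univ 1 u) (hw : MemA Set.univ 1 w) :
    MemA Set.univ p (fun x => u x * w x ^ (1 - p)) := by
  obtain ⟨hu, c, hc, hcu⟩ := hu.exists_average_le
  obtain ⟨hw, d, hd, hdw⟩ := hw.exists_average_le
  have hp1 : 0 < p - 1 := by linarith
  have hupos := hu.pos
  have hwpos := hw.pos
  have hmul : (1 - p) * (1 - p / (p - 1)) = 1 := by field_simp; ring
  have hq1 : 0 < p / (p - 1) - 1 := by
    rw [show p / (p - 1) - 1 = 1 / (p - 1) by field_simp; ring]
    positivity
  have hU := hu.measurable.ennreal_ofReal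
  have hW := hw.measurable.ennreal_ofReal
  have hm : Measurable fun x => u x * w x ^ (1 - p) :=
    hu.measurable.mul (hw.measurable.pow_const _)
  have e1 : ∀ᵐ x, ENNReal.ofReal (u x * w x ^ (1 - p)) =
      ENNReal.ofReal (u x) * ENNReal.ofReal (w x) ^ (-(p - 1)) := by
    rw [Measure.restrict_univ] at hupos hwpos
    filter_upwards [hupos, hwpos] with x h1 h2
    rw [ENNReal.ofReal_mul h1.le, ENNReal.ofReal_rpow_of_pos h2, neg_sub]
  have e2 : ∀ᵐ x, ENNReal.ofReal ((u x * w x ^ (1 - p)) ^ (1 - p / (p - 1))) =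
      ENNReal.ofReal (w x) * ENNReal.ofReal (u x) ^ (-(p / (p - 1) - 1)) := by
    rw [Measure.restrict_univ] at hupos hwpos
    filter_upwards [hupos, hwpos] with x h1 h2
    rw [Real.mul_rpow h1.le (Real.rpow_nonneg h2.le _), ← Real.rpow_mul h2.le, hmul, Real.rpow_one,
      mul_comm, ENNReal.ofReal_mul h2.le, ENNReal.ofReal_rpow_of_pos h1, neg_sub]
  have b1 : ∀ Q, IsCube Q → ((volume Q)⁻¹ * ∫⁻ y in Q, ENNReal.ofReal (w y)) ^ (p - 1) *
      ((volume Q)⁻¹ * ∫⁻ x in Q, ENNReal.ofReal (u x * w x ^ (1 - p))) ≤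
      d ^ (p - 1) * ((volume Q)⁻¹ * ∫⁻ x in Q, ENNReal.ofReal (u x)) := by
    intro Q hQ
    rw [lintegral_congr_ae (ae_restrict_of_ae e1)]
    exact rpow_mul_average_le hU (hw.average_ne hQ).2 hw.ofReal_ne (hdw Q hQ) hp1.le
  have b2 : ∀ Q, IsCube Q → ((volume Q)⁻¹ * ∫⁻ y in Q, ENNReal.ofReal (u y)) *
      ((volume Q)⁻¹ * ∫⁻ x in Q, ENNReal.ofReal ((u x * w x ^ (1 - p)) ^ (1 - p / (p - 1)))) ^
        (p - 1) ≤ c * ((volume Q)⁻¹ * ∫⁻ x in Q, ENNReal.ofReal (w x)) ^ (p - 1) := by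
    intro Q hQ
    rw [lintegral_congr_ae (ae_restrict_of_ae e2)]
    have := ENNReal.rpow_le_rpow (rpow_mul_average_le hW (hu.average_ne hQ).2 hu.ofReal_ne
      (hcu Q hQ) hq1.le) hp1.le
    rwa [ENNReal.mul_rpow_of_nonneg _ _ hp1.le, ENNReal.mul_rpow_of_nonneg (c ^ _) _ hp1.le,
      ← ENNReal.rpow_mul, ← ENNReal.rpow_mul,
      show (p / (p - 1) - 1) * (p - 1) = 1 by linarith, ENNReal.rpow_one,
      ENNReal.rpow_one] at this
  have hmw : ∀ Q, IsCube Q →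
      ((volume Q)⁻¹ * ∫⁻ y in Q, ENNReal.ofReal (w y)) ^ (p - 1) ≠ 0 ∧
      ((volume Q)⁻¹ * ∫⁻ y in Q, ENNReal.ofReal (w y)) ^ (p - 1) ≠ ⊤ := fun Q hQ =>
    ⟨by simp [ENNReal.rpow_eq_zero_iff, hw.average_ne hQ],
      ENNReal.rpow_ne_top_of_nonneg hp1.le (hw.average_ne hQ).2⟩
  refine Or.inr ⟨hp, ⟨hm, ?_, fun Q hQ _ => ⟨hm.aestronglyMeasurable, ?_⟩⟩, d ^ (p - 1) * c,
    ENNReal.mul_ne_top (ENNReal.rpow_ne_top_of_nonneg hp1.le hd) hc, fun Q hQ _ => ?_⟩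
  · filter_upwards [hupos, hwpos] with x h1 h2
    positivity
  · rw [Measure.restrict_univ] at hupos hwpos
    have hnn : 0 ≤ᵐ[volume.restrict Q] fun x => u x * w x ^ (1 - p) := by
      filter_upwards [ae_restrict_of_ae hupos, ae_restrict_of_ae hwpos] with x h1 h2
      show 0 ≤ u x * w x ^ (1 - p)
      positivity
    rw [hasFiniteIntegral_iff_ofReal hnn, lt_top_iff_ne_top]
    intro htop
    have := b1 Q hQ
    have hv : volume Q ≠ ⊤ := by
      obtain ⟨c, r, hr, rfl⟩ := isCube_iff_closedBall.1 hQ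
      exact volume_closedBall_ne_top c r
    rw [htop, ENNReal.mul_top (ENNReal.inv_ne_zero.2 hv), ENNReal.mul_top (hmw Q hQ).1,
      top_le_iff] at this
    exact ENNReal.mul_ne_top (ENNReal.rpow_ne_top_of_nonneg hp1.le hd) (hu.average_ne hQ).2 this
  · have h1 := b1 Q hQ
    have h2 := b2 Q hQ
    have hmu := hu.average_ne hQ
    have hmw := hmw Q hQ
    set mu := (volume Q)⁻¹ * ∫⁻ y in Q, ENNReal.ofReal (u y)
    set mw := ((volume Q)⁻¹ * ∫⁻ y in Q, ENNReal.ofReal (w y)) ^ (p - 1)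
    have h0 : mw * mu ≠ 0 := mul_ne_zero hmw.1 hmu.1
    have ht : mw * mu ≠ ⊤ := ENNReal.mul_ne_top hmw.2 hmu.2
    rw [← ENNReal.mul_le_mul_iff_right h0 ht]
    refine le_trans (le_of_eq ?_) ((mul_le_mul' h1 h2).trans_eq ?_) <;> ring

/-- An `A_p` weight together with its dual weight, in extended nonnegative form. -/
lemma MemA.exists_dual {n : ℕ} {p : ℝ} (hp : 1 < p) {w : (Fin n → ℝ) → ℝ}
    (hw : MemA Set.univ p w) : ∃ W S : (Fin n → ℝ) → ℝ≥0∞, W = (fun x => ENNReal.ofReal (w x)) ∧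
      Measurable W ∧ Measurable S ∧ (∀ᵐ x, W x ≠ 0 ∧ W x ≠ ⊤) ∧
      (∀ᵐ x, S x = W x ^ (1 - p / (p - 1))) ∧ ∃ C : ℝ≥0∞, C ≠ ⊤ ∧ ∀ x r, 0 < r →
      (∫⁻ y in Metric.closedBall x r, W y) * (∫⁻ y in Metric.closedBall x r, S y) ^ (p - 1) ≤
        C * volume (Metric.closedBall x r) ^ p := by
  rcases hw with ⟨h, _⟩ | ⟨_, hw, C, hC, hA⟩
  · exact absurd h hp.ne'
  have hp1 : 0 < p - 1 := by linarith
  refine ⟨_, fun x => ENNReal.ofReal (w x ^ (1 - p / (p - 1))), rfl, hw.measurable.ennreal_ofReal,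
    (hw.measurable.pow_const _).ennreal_ofReal, hw.ofReal_ne, ?_, C, hC, fun x r hr => ?_⟩
  · have hpos := hw.pos
    rw [Measure.restrict_univ] at hpos
    filter_upwards [hpos] with x hx
    rw [ENNReal.ofReal_rpow_of_pos hx]
  · have h := hA _ (isCube_iff_closedBall.2 ⟨x, r, hr, rfl⟩) (Set.subset_univ _)
    have hv0 := volume_closedBall_ne_zero x hr
    have hvt := volume_closedBall_ne_top x r
    set v := volume (Metric.closedBall x r)
    set a := ∫⁻ y in Metric.closedBall x r, ENNReal.ofReal (w y)
    set b := ∫⁻ y in Metric.closedBall x r, ENNReal.ofReal (w y ^ (1 - p / (p - 1)))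
    have hvp : v ^ p = v * v ^ (p - 1) := by
      nth_rewrite 2 [← ENNReal.rpow_one v]
      rw [← ENNReal.rpow_add _ _ hv0 hvt, add_sub_cancel]
    have hvp0 : v ^ (p - 1) ≠ 0 := by simp [ENNReal.rpow_eq_zero_iff, hv0, hvt]
    have hvpt : v ^ (p - 1) ≠ ⊤ := ENNReal.rpow_ne_top_of_nonneg hp1.le hvt
    calc a * b ^ (p - 1)
        = a * b ^ (p - 1) * (v * v⁻¹) * (v ^ (p - 1) * (v ^ (p - 1))⁻¹) := by
          rw [ENNReal.mul_inv_cancel hv0 hvt, ENNReal.mul_inv_cancel hvp0 hvpt, mul_one, mul_one]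
      _ = (v⁻¹ * a) * (v⁻¹ * b) ^ (p - 1) * v ^ p := by
          rw [ENNReal.mul_rpow_of_nonneg _ _ hp1.le, ENNReal.inv_rpow, hvp]
          ring
      _ ≤ C * v ^ p := by gcongr

theorem stmt8 (n : ℕ) (p : ℝ) (hp : 1 < p) :
    {f : (Fin n → ℝ) → ℝ | ∃ w, MemA Set.univ p w ∧ MemLw Set.univ p w f} =
      {f | HasApMajorant Set.univ 1 f} ∩
        {f | ∃ u, MemA Set.univ 1 u ∧ MemLw Set.univ 1 u f} := by
  ext f
  constructor
  · rintro ⟨w, hw, hf, hfw⟩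
    obtain ⟨W, S, hWw, hWm, hSm, hW, hS, C, hC, hA⟩ := hw.exists_dual hp
    have hpq : p.HolderConjugate (p / (p - 1)) := Real.HolderConjugate.conjExponent hp
    set q := p / (p - 1) with hq
    have hp1 : 0 < p - 1 := by linarith
    have hq1 : 0 < q - 1 := by linarith [hpq.symm.lt]
    have hpq1 : (p - 1) * (q - 1) = 1 := by linarith [hpq.mul_eq_add]
    have hF : Measurable fun x => ENNReal.ofReal |f x| := (measurable_abs.comp hf).ennreal_ofReal
    rw [setLIntegral_univ] at hfw
    have hS' : ∀ᵐ x, S x ≠ 0 ∧ S x ≠ ⊤ := by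
      filter_upwards [hW, hS] with x h1 h2
      rw [h2]
      exact ⟨by simp [ENNReal.rpow_eq_zero_iff, h1.1, h1.2],
        by simp [ENNReal.rpow_eq_top_iff, h1.1, h1.2]⟩
    have hWS : ∀ᵐ x, W x = S x ^ (1 - p) := by
      filter_upwards [hS] with x h2
      rw [h2, ← ENNReal.rpow_mul, show (1 - q) * (1 - p) = 1 by linarith, ENNReal.rpow_one]
    have hA' : ∀ x r, 0 < r →
        (∫⁻ y in Metric.closedBall x r, S y) * (∫⁻ y in Metric.closedBall x r, W y) ^ (q - 1) ≤
        C ^ (q - 1) * volume (Metric.closedBall x r) ^ q := by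
      intro x r hr
      have := ENNReal.rpow_le_rpow (hA x r hr) hq1.le
      rwa [ENNReal.mul_rpow_of_nonneg _ _ hq1.le, ENNReal.mul_rpow_of_nonneg _ _ hq1.le,
        ← ENNReal.rpow_mul, ← ENNReal.rpow_mul, hpq1, ENNReal.rpow_one, mul_comm,
        show p * (q - 1) = q by linarith] at this
    constructor
    · obtain ⟨K, hK, hM⟩ := exists_weighted_bound_dyadicMax hpq hWm hSm hW hS hC hA
      obtain ⟨u, hu, hfu, _⟩ := exists_memA1_majorant hp hWm hW hK hM hF (by rw [hWw]; exact hfw)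
      refine ⟨hf, u, hu, ?_⟩
      have hupos := hu.exists_average_le.1.pos
      filter_upwards [hupos, ae_restrict_of_ae hfu] with x h1 h2
      exact (ENNReal.ofReal_le_ofReal_iff h1.le).1 h2
    · obtain ⟨K, hK, hM⟩ := exists_weighted_bound_dyadicMax hpq.symm hSm hWm hS' hWS
        (ENNReal.rpow_ne_top_of_nonneg hq1.le hC) hA'
      obtain ⟨u, hu, _, hup⟩ := exists_memA1_majorant hpq.symm.lt hSm hS' hK hM
        (measurable_const (a := (0 : ℝ≥0∞))) (by simp [hpq.symm.pos])
      refine ⟨u, hu, hf, ?_⟩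
      rw [setLIntegral_univ]
      have hFW : Measurable fun x => ENNReal.ofReal |f x| ^ p * W x := (hF.pow_const p).mul hWm
      have hfw' : ∫⁻ x, ENNReal.ofReal |f x| ^ p * W x < ⊤ := by rw [hWw]; exact hfw
      refine lt_of_le_of_lt ?_ (ENNReal.add_lt_top.2 ⟨hfw', hup⟩)
      rw [← lintegral_add_left hFW]
      refine lintegral_mono_ae ?_
      filter_upwards [hW, hS] with x h1 h2
      set F := ENNReal.ofReal |f x|
      set U := ENNReal.ofReal (u x)
      have hle : ∀ {a : ℝ≥0∞} {s : ℝ}, 1 < s → a / ENNReal.ofReal s ≤ a := fun hs =>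
        ENNReal.div_le_of_le_mul (le_mul_of_one_le_right' (by simpa using hs.le))
      calc F ^ (1 : ℝ) * U = (F * W x ^ p⁻¹) * (U * W x ^ (-p⁻¹)) := by
            calc _ = F * U * (W x ^ p⁻¹ * W x ^ (-p⁻¹)) := by
                  rw [← ENNReal.rpow_add _ _ h1.1 h1.2, add_neg_cancel, ENNReal.rpow_zero,
                    mul_one, ENNReal.rpow_one]
              _ = _ := by ring
        _ ≤ (F * W x ^ p⁻¹) ^ p + (U * W x ^ (-p⁻¹)) ^ q :=
            (ENNReal.young_inequality _ _ hpq).trans (add_le_add (hle hp) (hle hpq.symm.lt))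
        _ = F ^ p * W x + U ^ q * S x := by
            rw [ENNReal.mul_rpow_of_nonneg _ _ hpq.nonneg,
              ENNReal.mul_rpow_of_nonneg _ _ hpq.symm.nonneg,
              ENNReal.rpow_inv_rpow hpq.ne_zero, h2, ← ENNReal.rpow_mul]
            congr 3
            have := hpq.ne_zero
            field_simp
            linarith [hpq.mul_eq_add]
  · rintro ⟨⟨hf, w, hw, hfw⟩, u, hu, _, hfu⟩
    refine ⟨fun x => u x * w x ^ (1 - p), memA_mul_rpow hp hu hw, hf, ?_⟩
    refine lt_of_le_of_lt (lintegral_mono_ae ?_) hfu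
    filter_upwards [hfw, hw.exists_average_le.1.pos, hu.exists_average_le.1.pos] with x h1 h2 h3
    rw [ENNReal.ofReal_rpow_of_nonneg (abs_nonneg _) (by linarith),
      ← ENNReal.ofReal_mul (by positivity), ENNReal.rpow_one, ← ENNReal.ofReal_mul (by positivity)]
    refine ENNReal.ofReal_le_ofReal ?_
    have h4 : |f x| ^ p = |f x| * |f x| ^ (p - 1) := by
      nth_rewrite 2 [← Real.rpow_one |f x|]
      rw [← Real.rpow_add_of_nonneg (abs_nonneg _) zero_le_one (by linarith), add_sub_cancel]
    have h5 : |f x| ^ (p - 1) ≤ w x ^ (p - 1) :=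
      Real.rpow_le_rpow (abs_nonneg _) h1 (by linarith)
    calc |f x| ^ p * (u x * w x ^ (1 - p)) ≤ |f x| * w x ^ (p - 1) * (u x * w x ^ (1 - p)) := by
          rw [h4]; gcongr
      _ = |f x| * u x * (w x ^ (p - 1) * w x ^ (1 - p)) := by ring
      _ = |f x| * u x := by
          rw [← Real.rpow_add h2, show p - 1 + (1 - p) = 0 by ring, Real.rpow_zero, mul_one]
end

section
/- If 1 < p, q < ∞, then the union over w ∈ A_p(ℝ^n) of L^p_w(ℝ^n) equals the union over w ∈ A_q(ℝ^n) of L^q_w(ℝ^n). -/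
open MeasureTheory ENNReal

open Set Metric

section CenteredMaximal

variable {α : Type*} [MetricSpace α] [MeasurableSpace α]

/-- The centered maximal function of `g` with respect to the measure `ν`, over rational radii. -/
noncomputable def centeredMaximal (ν : Measure α) (g : α → ℝ≥0∞) (x : α) : ℝ≥0∞ :=
  ⨆ r : ℚ, (∫⁻ y in ball x (r : ℝ), g y ∂ν) / ν (ball x (r : ℝ))

theorem measurable_setLIntegral_ball [SecondCountableTopology α] [BorelSpace α]
    (ν : Measure α) [SFinite ν] {g : α → ℝ≥0∞} (hg : Measurable g) (r : ℝ) :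
    Measurable fun x => ∫⁻ y in ball x r, g y ∂ν := by
  have hs : MeasurableSet {z : α × α | dist z.2 z.1 < r} :=
    (isOpen_lt (continuous_snd.dist continuous_fst) continuous_const).measurableSet
  have h := Measurable.lintegral_prod_right' (ν := ν) ((hg.comp measurable_snd).indicator hs)
  convert h using 2 with x
  rw [← lintegral_indicator measurableSet_ball]
  rfl

theorem measurable_centeredMaximal [SecondCountableTopology α] [BorelSpace α]
    (ν : Measure α) [SFinite ν] {g : α → ℝ≥0∞} (hg : Measurable g) :
    Measurable (centeredMaximal ν g) := by
  refine Measurable.iSup fun r => (measurable_setLIntegral_ball ν hg r).div ?_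
  simpa using measurable_setLIntegral_ball ν (g := fun _ => 1) measurable_const r

theorem exists_weakType_centeredMaximal [SecondCountableTopology α] [BorelSpace α]
    [HasBesicovitchCovering α] :
    ∃ N : ℕ, ∀ (ν : Measure α) (g : α → ℝ≥0∞) (t : ℝ≥0∞),
      t * ν {x | t < centeredMaximal ν g x} ≤ N * ∫⁻ x, g x ∂ν := by
  obtain ⟨N, τ, hτ, hN⟩ := HasBesicovitchCovering.no_satelliteConfig (α := α)
  refine ⟨N, fun ν g t => ?_⟩
  let S : ℕ → Set α := fun K =>
    {x | ∃ r : ℚ, (r : ℝ) ≤ K ∧ t < (∫⁻ y in ball x (r : ℝ), g y ∂ν) / ν (ball x (r : ℝ))}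
  have hS : {x | t < centeredMaximal ν g x} = ⋃ K, S K := by
    ext x
    simp only [centeredMaximal, lt_iSup_iff, mem_ofPred_eq, mem_iUnion, S]
    constructor
    · rintro ⟨r, hr⟩
      obtain ⟨K, hK⟩ := exists_nat_ge (r : ℝ)
      exact ⟨K, r, hK, hr⟩
    · rintro ⟨K, r, -, hr⟩
      exact ⟨r, hr⟩
  have hmono : Monotone S := by
    rintro K L hKL x ⟨r, hr, h⟩
    exact ⟨r, hr.trans (by exact_mod_cast hKL), h⟩
  rw [hS, hmono.measure_iUnion, ENNReal.mul_iSup]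
  refine iSup_le fun K => ?_
  choose r hrK hr using fun x : S K => x.2
  have hpos : ∀ x, 0 < (r x : ℝ) := by
    intro x
    by_contra! h
    have := hr x
    simp [ball_eq_empty.2 h] at this
  let P : Besicovitch.BallPackage (S K) α :=
    { c := Subtype.val
      r := fun x => r x
      rpos := hpos
      r_bound := K
      r_le := hrK }
  obtain ⟨s, hdisj, hcover⟩ := Besicovitch.exist_disjoint_covering_families hτ hN P
  have hdisj' : ∀ i, (s i).PairwiseDisjoint fun j => ball (P.c j) (P.r j) := fun i a ha b hb hab =>
    (hdisj i ha hb hab).mono ball_subset_closedBall ball_subset_closedBall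
  have hcount : ∀ i, (s i).Countable := fun i =>
    (hdisj' i).countable_of_isOpen (fun _ _ => isOpen_ball) fun j _ => ⟨_, mem_ball_self (P.rpos j)⟩
  have hfam : ∀ i, t * ν (⋃ j ∈ s i, ball (P.c j) (P.r j)) ≤ ∫⁻ x, g x ∂ν := fun i => by
    calc t * ν (⋃ j ∈ s i, ball (P.c j) (P.r j))
        = ∑' j : s i, t * ν (ball (P.c j) (P.r j)) := by
          rw [measure_biUnion (hcount i) (hdisj' i) fun _ _ => measurableSet_ball,
            ENNReal.tsum_mul_left]
      _ ≤ ∑' j : s i, ∫⁻ y in ball (P.c j) (P.r j), g y ∂ν :=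
          ENNReal.tsum_le_tsum fun j => (ENNReal.mul_lt_of_lt_div (hr j)).le
      _ = ∫⁻ y in ⋃ j ∈ s i, ball (P.c j) (P.r j), g y ∂ν :=
          (lintegral_biUnion (hcount i) (fun _ _ => measurableSet_ball) (hdisj' i) _).symm
      _ ≤ ∫⁻ x, g x ∂ν := setLIntegral_le_lintegral _ _
  have hsub : S K ⊆ ⋃ i, ⋃ j ∈ s i, ball (P.c j) (P.r j) := by
    have : range P.c = S K := Subtype.range_val
    rwa [this] at hcover
  calc t * ν (S K) ≤ t * ∑ i, ν (⋃ j ∈ s i, ball (P.c j) (P.r j)) := by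
        gcongr
        exact (measure_mono hsub).trans (measure_iUnion_fintype_le _ _)
    _ = ∑ i, t * ν (⋃ j ∈ s i, ball (P.c j) (P.r j)) := Finset.mul_sum _ _ _
    _ ≤ ∑ _i : Fin N, ∫⁻ x, g x ∂ν := Finset.sum_le_sum fun i _ => hfam i
    _ = N * ∫⁻ x, g x ∂ν := by simp

theorem centeredMaximal_le_add (ν : Measure α) (g : α → ℝ≥0∞)
    (t : ℝ≥0∞) (x : α) :
    centeredMaximal ν g x ≤ centeredMaximal ν ({y | t < g y}.indicator g) x + t := by
  have hle : ∀ y, g y ≤ {y | t < g y}.indicator g y + t := fun y => by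
    by_cases h : t < g y
    · simp [indicator_of_mem (show y ∈ {y | t < g y} from h)]
    · exact (not_lt.1 h).trans le_add_self
  refine iSup_le fun r => ?_
  calc (∫⁻ y in ball x (r : ℝ), g y ∂ν) / ν (ball x (r : ℝ))
      ≤ (∫⁻ y in ball x (r : ℝ), {y | t < g y}.indicator g y ∂ν + t * ν (ball x (r : ℝ))) /
          ν (ball x (r : ℝ)) := by
        gcongr
        rw [← setLIntegral_const, ← lintegral_add_right _ measurable_const]
        exact lintegral_mono hle
    _ = (∫⁻ y in ball x (r : ℝ), {y | t < g y}.indicator g y ∂ν) / ν (ball x (r : ℝ)) +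
          t * ν (ball x (r : ℝ)) / ν (ball x (r : ℝ)) := ENNReal.add_div
    _ ≤ _ := by
        gcongr
        · exact le_iSup (fun r : ℚ => (∫⁻ y in ball x (r : ℝ), {y | t < g y}.indicator g y ∂ν) /
            ν (ball x (r : ℝ))) r
        · exact ENNReal.div_le_of_le_mul le_rfl

end CenteredMaximal

section LayerCake

variable {α : Type*} [MeasurableSpace α] {μ : Measure α} {f : α → ℝ≥0∞} {p : ℝ}

theorem ENNReal.lintegral_rpow_eq_lintegral_meas_lt_mul (hf : Measurable f)
    (hfin : ∀ᵐ x ∂μ, f x ≠ ∞) (hp : 0 < p) :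
    ∫⁻ x, f x ^ p ∂μ =
      ENNReal.ofReal p * ∫⁻ t in Ioi (0 : ℝ),
        μ {x | ENNReal.ofReal t < f x} * ENNReal.ofReal (t ^ (p - 1)) := by
  have h := _root_.MeasureTheory.lintegral_rpow_eq_lintegral_meas_lt_mul μ (f := fun x => (f x).toReal)
    (Filter.Eventually.of_forall fun _ => ENNReal.toReal_nonneg) hf.ennreal_toReal.aemeasurable hp
  calc ∫⁻ x, f x ^ p ∂μ = ∫⁻ x, ENNReal.ofReal ((f x).toReal ^ p) ∂μ := by
        refine lintegral_congr_ae ?_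
        filter_upwards [hfin] with x hx
        rw [← ENNReal.ofReal_rpow_of_nonneg ENNReal.toReal_nonneg hp.le, ENNReal.ofReal_toReal hx]
    _ = _ := h
    _ = _ := by
        congr 1
        refine setLIntegral_congr_fun measurableSet_Ioi fun t ht => ?_
        congr 1
        refine measure_congr ?_
        filter_upwards [hfin] with x hx
        exact propext (ENNReal.ofReal_lt_iff_lt_toReal (le_of_lt ht) hx).symm

theorem ENNReal.lintegral_rpow_le_lintegral_meas_lt_mul (hf : Measurable f) (hp : 0 < p) :
    ∫⁻ x, f x ^ p ∂μ ≤
      ENNReal.ofReal p * ∫⁻ t in Ioi (0 : ℝ),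
        μ {x | ENNReal.ofReal t < f x} * ENNReal.ofReal (t ^ (p - 1)) := by
  have hsup : ∀ x, f x ^ p = ⨆ K : ℕ, min (f x) K ^ p := fun x => by
    have h1 : f x = ⨆ K : ℕ, min (f x) K := by
      rw [← inf_iSup_eq, ENNReal.iSup_natCast, inf_top_eq]
    conv_lhs => rw [h1]
    exact (ENNReal.orderIsoRpow p hp).map_iSup _
  simp_rw [hsup]
  rw [lintegral_iSup fun K => (hf.min measurable_const).pow_const p]
  · refine iSup_le fun K => ?_
    rw [ENNReal.lintegral_rpow_eq_lintegral_meas_lt_mul (hf.min measurable_const)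
      (Filter.Eventually.of_forall fun x => ((min_le_right _ _).trans_lt
        (ENNReal.natCast_lt_top K)).ne) hp]
    gcongr with t x
    exact min_le_left _ _
  · intro K L hKL x
    dsimp only
    gcongr

end LayerCake

theorem exists_strongType_centeredMaximal {α : Type*} [MetricSpace α] [MeasurableSpace α]
    [SecondCountableTopology α] [BorelSpace α] [HasBesicovitchCovering α] {p : ℝ} (hp : 1 < p) :
    ∃ K : ℝ≥0∞, K ≠ ∞ ∧ ∀ (ν : Measure α) [SFinite ν] (g : α → ℝ≥0∞), Measurable g →
      ∫⁻ x, centeredMaximal ν g x ^ p ∂ν ≤ K * ∫⁻ x, g x ^ p ∂ν := by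
  obtain ⟨N, hN⟩ := exists_weakType_centeredMaximal (α := α)
  have hp0 : 0 < p := by linarith
  have hp1 : 0 < p - 1 := by linarith
  have hc : ENNReal.ofReal (p - 1) ≠ 0 := by simpa using hp1
  refine ⟨ENNReal.ofReal p * (2 * N * ((ENNReal.ofReal (p - 1))⁻¹ * 2 ^ (p - 1))) + 1, ?_,
    fun ν _ g hg => ?_⟩
  · refine ENNReal.add_ne_top.2 ⟨?_, by simp⟩
    have : (2 : ℝ≥0∞) ^ (p - 1) ≠ ∞ := ENNReal.rpow_ne_top_of_nonneg hp1.le (by simp)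
    have := ENNReal.inv_ne_top.2 hc
    finiteness
  by_cases htop : ∫⁻ x, g x ^ p ∂ν = ∞
  · simp [htop]
  have hgfin : ∀ᵐ x ∂ν, g x ≠ ∞ := by
    filter_upwards [ae_lt_top (hg.pow_const p) htop] with x hx h
    simp [h, hp0] at hx
  let νg := ν.withDensity g
  have hlevel : ∀ t ∈ Ioi (0 : ℝ),
      ν {x | ENNReal.ofReal t < centeredMaximal ν g x} * ENNReal.ofReal (t ^ (p - 1)) ≤
        2 * N * (νg {x | ENNReal.ofReal t < 2 * g x} * ENNReal.ofReal (t ^ (p - 1 - 1))) := by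
    intro t ht
    have ht : 0 < t := ht
    have h2 : ENNReal.ofReal t = ENNReal.ofReal (t / 2) + ENNReal.ofReal (t / 2) := by
      rw [← ENNReal.ofReal_add (by positivity) (by positivity), add_halves]
    have hE : MeasurableSet {x | ENNReal.ofReal (t / 2) < g x} := measurableSet_lt measurable_const hg
    have hsub : {x | ENNReal.ofReal t < centeredMaximal ν g x} ⊆ {x | ENNReal.ofReal (t / 2) <
        centeredMaximal ν ({y | ENNReal.ofReal (t / 2) < g y}.indicator g) x} := fun x hx => by
      have := lt_of_lt_of_le hx (centeredMaximal_le_add ν g (ENNReal.ofReal (t / 2)) x)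
      rw [h2] at this
      exact lt_of_add_lt_add_right this
    have hset : {x | ENNReal.ofReal (t / 2) < g x} ⊆ {x | ENNReal.ofReal t < 2 * g x} := fun x hx => by
      have hx : ENNReal.ofReal (t / 2) < g x := hx
      change _ < 2 * g x
      rw [h2, two_mul]
      exact ENNReal.add_lt_add hx hx
    have hweak : ENNReal.ofReal (t / 2) * ν {x | ENNReal.ofReal t < centeredMaximal ν g x} ≤
        N * νg {x | ENNReal.ofReal t < 2 * g x} := by
      calc _ ≤ ENNReal.ofReal (t / 2) * ν {x | ENNReal.ofReal (t / 2) <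
            centeredMaximal ν ({y | ENNReal.ofReal (t / 2) < g y}.indicator g) x} := by gcongr
        _ ≤ N * ∫⁻ x, {y | ENNReal.ofReal (t / 2) < g y}.indicator g x ∂ν := hN _ _ _
        _ = N * νg {x | ENNReal.ofReal (t / 2) < g x} := by
            rw [lintegral_indicator hE, withDensity_apply _ hE]
        _ ≤ _ := by gcongr
    have hpow : ENNReal.ofReal (t ^ (p - 1)) =
        2 * (ENNReal.ofReal (t / 2) * ENNReal.ofReal (t ^ (p - 1 - 1))) := by
      rw [← ENNReal.ofReal_mul (by positivity), ← ENNReal.ofReal_ofNat 2,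
        ← ENNReal.ofReal_mul (by positivity), Real.rpow_sub_one ht.ne' (p - 1)]
      congr 1
      field_simp
    calc _ = 2 * ENNReal.ofReal (t ^ (p - 1 - 1)) *
          (ENNReal.ofReal (t / 2) * ν {x | ENNReal.ofReal t < centeredMaximal ν g x}) := by
          rw [hpow]; ring
      _ ≤ 2 * ENNReal.ofReal (t ^ (p - 1 - 1)) * (N * νg {x | ENNReal.ofReal t < 2 * g x}) := by
          gcongr
      _ = _ := by ring
  have hcake := ENNReal.lintegral_rpow_eq_lintegral_meas_lt_mul (μ := νg) (f := fun x => 2 * g x)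
    (hg.const_mul 2) ((withDensity_absolutelyContinuous ν g).ae_le (by
      filter_upwards [hgfin] with x hx using ENNReal.mul_ne_top (by simp) hx)) hp1
  have hnorm : ∫⁻ x, (2 * g x) ^ (p - 1) ∂νg = 2 ^ (p - 1) * ∫⁻ x, g x ^ p ∂ν := by
    rw [lintegral_withDensity_eq_lintegral_mul _ hg ((hg.const_mul 2).pow_const _),
      ← lintegral_const_mul _ (hg.pow_const p)]
    refine lintegral_congr fun x => ?_
    simp only [Pi.mul_apply]
    rw [ENNReal.mul_rpow_of_nonneg _ _ hp1.le, mul_left_comm]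
    congr 1
    conv_lhs => rw [← ENNReal.rpow_one (g x), ← ENNReal.rpow_mul, one_mul]
    rw [← ENNReal.rpow_add_of_nonneg _ _ zero_le_one hp1.le]
    congr 1
    ring
  calc ∫⁻ x, centeredMaximal ν g x ^ p ∂ν
      ≤ ENNReal.ofReal p * ∫⁻ t in Ioi (0 : ℝ),
        ν {x | ENNReal.ofReal t < centeredMaximal ν g x} * ENNReal.ofReal (t ^ (p - 1)) :=
        ENNReal.lintegral_rpow_le_lintegral_meas_lt_mul (measurable_centeredMaximal ν hg) hp0
    _ ≤ ENNReal.ofReal p * ∫⁻ t in Ioi (0 : ℝ),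
        2 * N * (νg {x | ENNReal.ofReal t < 2 * g x} * ENNReal.ofReal (t ^ (p - 1 - 1))) := by
        gcongr ENNReal.ofReal p * ?_
        exact setLIntegral_mono' measurableSet_Ioi hlevel
    _ = ENNReal.ofReal p * (2 * N * ((ENNReal.ofReal (p - 1))⁻¹ *
          ∫⁻ x, (2 * g x) ^ (p - 1) ∂νg)) := by
        rw [lintegral_const_mul' _ _ (by finiteness), hcake, ENNReal.inv_mul_cancel_left hc (by simp)]
    _ = ENNReal.ofReal p * (2 * N * ((ENNReal.ofReal (p - 1))⁻¹ * 2 ^ (p - 1))) *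
          ∫⁻ x, g x ^ p ∂ν := by rw [hnorm]; ring
    _ ≤ _ := by gcongr; exact le_self_add

section BallMaximal

variable {n : ℕ}

/-- The uncentered Hardy–Littlewood maximal function over open balls of the sup norm, that is,
over open cubes. -/
noncomputable def ballMaximal (f : (Fin n → ℝ) → ℝ≥0∞) (x : Fin n → ℝ) : ℝ≥0∞ :=
  ⨆ (z : Fin n → ℝ) (r : ℝ) (_ : x ∈ ball z r), (∫⁻ y in ball z r, f y) / volume (ball z r)

theorem average_le_ballMaximal (f : (Fin n → ℝ) → ℝ≥0∞) {x z : Fin n → ℝ} {r : ℝ}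
    (hx : x ∈ ball z r) : (∫⁻ y in ball z r, f y) / volume (ball z r) ≤ ballMaximal f x :=
  le_iSup_of_le z <| le_iSup_of_le r <| le_iSup_of_le hx le_rfl

theorem measurable_ballMaximal (f : (Fin n → ℝ) → ℝ≥0∞) : Measurable (ballMaximal f) := by
  refine measurable_of_Ioi fun t => IsOpen.measurableSet (isOpen_iff_mem_nhds.2 fun x hx => ?_)
  simp only [ballMaximal, mem_preimage, mem_Ioi, lt_iSup_iff] at hx
  obtain ⟨z, r, hxr, ht⟩ := hx
  filter_upwards [isOpen_ball.mem_nhds hxr] with y hy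
  exact ht.trans_le (average_le_ballMaximal f hy)

theorem ballMaximal_tsum_le {ι : Type*} [Countable ι] (c : ι → ℝ≥0∞)
    {a : ι → (Fin n → ℝ) → ℝ≥0∞} (ha : ∀ k, Measurable (a k)) (x : Fin n → ℝ) :
    ballMaximal (fun y => ∑' k, c k * a k y) x ≤ ∑' k, c k * ballMaximal (a k) x := by
  refine iSup_le fun z => iSup_le fun r => iSup_le fun hx => ?_
  rw [lintegral_tsum fun k => ((ha k).const_mul _).aemeasurable, div_eq_mul_inv,
    ← ENNReal.tsum_mul_right]
  refine ENNReal.tsum_le_tsum fun k => ?_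
  rw [lintegral_const_mul _ (ha k), mul_assoc, ← div_eq_mul_inv]
  gcongr
  exact average_le_ballMaximal _ hx

end BallMaximal

theorem ENNReal.mul_inv_rpow_mul {a : ℝ≥0∞} (ha : a ≠ 0) (ha' : a ≠ ∞) (b : ℝ≥0∞) {p : ℝ}
    (hp : 0 ≤ p) : (b * a⁻¹) ^ p * a = b ^ p * a ^ (1 - p) := by
  rw [ENNReal.mul_rpow_of_nonneg _ _ hp, mul_assoc, ENNReal.inv_rpow, ← ENNReal.rpow_neg,
    sub_eq_neg_add, ENNReal.rpow_add _ _ ha ha', ENNReal.rpow_one]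

/-- `W` is an everywhere positive and finite `A_p` weight with dual weight `V = W^(1-p')`,
the `A_p` condition being stated on open balls of the sup norm. -/
structure IsApPair {n : ℕ} (p p' : ℝ) (W V : (Fin n → ℝ) → ℝ≥0∞) : Prop where
  conj : p.HolderConjugate p'
  measurable : Measurable W
  ne_zero : ∀ x, W x ≠ 0
  ne_top : ∀ x, W x ≠ ∞
  dual_eq : ∀ x, V x = W x ^ (1 - p')
  bound : ∃ C : ℝ≥0∞, C ≠ ∞ ∧ ∀ (z : Fin n → ℝ) (r : ℝ), 0 < r →
    (∫⁻ x in ball z r, W x) * (∫⁻ x in ball z r, V x) ^ (p - 1) ≤ C * volume (ball z r) ^ p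

namespace IsApPair

variable {n : ℕ} {p p' : ℝ} {W V : (Fin n → ℝ) → ℝ≥0∞}

theorem one_sub_mul_one_sub (h : p.HolderConjugate p') : (1 - p') * (1 - p) = 1 := by
  have := h.sub_one_mul_conj
  linarith

theorem symm (h : IsApPair p p' W V) : IsApPair p' p V W where
  conj := h.conj.symm
  measurable := by
    rw [funext h.dual_eq]
    exact h.measurable.pow_const _
  ne_zero x := by
    rw [h.dual_eq]
    simp [ENNReal.rpow_eq_zero_iff, h.ne_zero x, h.ne_top x]
  ne_top x := by
    rw [h.dual_eq]
    simp [ENNReal.rpow_eq_top_iff, h.ne_zero x, h.ne_top x]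
  dual_eq x := by
    rw [h.dual_eq, ← ENNReal.rpow_mul, one_sub_mul_one_sub h.conj, ENNReal.rpow_one]
  bound := by
    obtain ⟨C, hC, hb⟩ := h.bound
    have hp' : 0 < p' - 1 := h.conj.symm.sub_one_pos
    have hmul : (p - 1) * (p' - 1) = 1 := by linarith [one_sub_mul_one_sub h.conj]
    have hp : p * (p' - 1) = p' := by
      rw [mul_comm]; exact h.conj.symm.sub_one_mul_conj
    refine ⟨C ^ (p' - 1), ENNReal.rpow_ne_top_of_nonneg hp'.le hC, fun z r hr => ?_⟩
    have := ENNReal.rpow_le_rpow (hb z r hr) hp'.le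
    rwa [ENNReal.mul_rpow_of_nonneg _ _ hp'.le, ENNReal.mul_rpow_of_nonneg _ _ hp'.le,
      ← ENNReal.rpow_mul, ← ENNReal.rpow_mul, hmul, hp, ENNReal.rpow_one, mul_comm] at this

theorem setLIntegral_ball_ne_zero (h : IsApPair p p' W V) (z : Fin n → ℝ) {r : ℝ} (hr : 0 < r) :
    ∫⁻ x in ball z r, W x ≠ 0 := by
  rw [← pos_iff_ne_zero, lintegral_pos_iff_support h.measurable]
  have : Function.support W = univ := eq_univ_of_forall h.ne_zero
  simpa [this] using measure_ball_pos volume z hr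

theorem setLIntegral_ball_ne_top (h : IsApPair p p' W V) (z : Fin n → ℝ) {r : ℝ} (hr : 0 < r) :
    ∫⁻ x in ball z r, W x ≠ ∞ := by
  obtain ⟨C, hC, hb⟩ := h.bound
  intro htop
  have h0 : (∫⁻ x in ball z r, V x) ^ (p - 1) ≠ 0 := by
    simp [ENNReal.rpow_eq_zero_iff, h.symm.setLIntegral_ball_ne_zero z hr, h.conj.lt.le]
  have := hb z r hr
  rw [htop, ENNReal.top_mul h0, top_le_iff] at this
  exact ENNReal.mul_ne_top hC (ENNReal.rpow_ne_top_of_nonneg h.conj.nonneg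
    measure_ball_lt_top.ne) this

theorem setLIntegral_div_withDensity (h : IsApPair p p' W V) {f : (Fin n → ℝ) → ℝ≥0∞}
    (hf : Measurable f) {s : Set (Fin n → ℝ)} (hs : MeasurableSet s) :
    ∫⁻ y in s, f y * (W y)⁻¹ ∂(volume.withDensity W) = ∫⁻ y in s, f y := by
  have hfW : Measurable fun y => f y * (W y)⁻¹ := hf.mul h.measurable.inv
  rw [setLIntegral_withDensity_eq_setLIntegral_mul _ h.measurable hfW hs]
  refine lintegral_congr fun y => ?_
  simp only [Pi.mul_apply]
  rw [mul_left_comm, ENNReal.mul_inv_cancel (h.ne_zero y) (h.ne_top y), mul_one]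

theorem setLIntegral_div_le_centeredMaximal (h : IsApPair p p' W V) {f : (Fin n → ℝ) → ℝ≥0∞}
    (hf : Measurable f) {x z : Fin n → ℝ} {r : ℝ} (hx : x ∈ ball z r) :
    (∫⁻ y in ball z r, f y) / (∫⁻ y in ball z (4 * r), W y) ≤
      centeredMaximal (volume.withDensity W) (fun y => f y * (W y)⁻¹) x := by
  have hr : 0 < r := pos_of_mem_ball hx
  have hx' : dist x z < r := hx
  obtain ⟨R, hR, hR'⟩ := exists_rat_btwn (show 2 * r < 3 * r by linarith)
  refine le_iSup_of_le R ?_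
  rw [h.setLIntegral_div_withDensity hf measurableSet_ball, withDensity_apply _ measurableSet_ball]
  refine ENNReal.div_le_div (lintegral_mono_set ?_) (lintegral_mono_set ?_)
  · exact ball_subset_ball' (by rw [dist_comm z x]; linarith)
  · exact ball_subset_ball' (by linarith)

theorem exists_ballMaximal_rpow_le (h : IsApPair p p' W V) :
    ∃ D : ℝ≥0∞, D ≠ ∞ ∧ ∀ f : (Fin n → ℝ) → ℝ≥0∞, Measurable f → ∀ x,
      ballMaximal f x ^ (p - 1) ≤ D * centeredMaximal (volume.withDensity W)
        (fun y => centeredMaximal (volume.withDensity V) (fun y => f y * (V y)⁻¹) y ^ (p - 1) *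
          (W y)⁻¹) x := by
  obtain ⟨C, hC, hb⟩ := h.bound
  have hp1 : 0 < p - 1 := h.conj.sub_one_pos
  have hp0 : 0 ≤ p := h.conj.nonneg
  refine ⟨C * (4 ^ n : ℝ≥0∞) ^ p, ENNReal.mul_ne_top hC (ENNReal.rpow_ne_top_of_nonneg hp0
    (by finiteness)), fun f hf x => ?_⟩
  set T := centeredMaximal (volume.withDensity W) (fun y => centeredMaximal (volume.withDensity V)
    (fun y => f y * (V y)⁻¹) y ^ (p - 1) * (W y)⁻¹) x with hT
  rw [← ENNReal.le_rpow_inv_iff hp1]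
  refine iSup_le fun z => iSup_le fun r => iSup_le fun hx => ?_
  rw [ENNReal.le_rpow_inv_iff hp1]
  have hr : 0 < r := pos_of_mem_ball hx
  set b := volume (ball z r) with hb_def
  have hb0 : b ≠ 0 := (measure_ball_pos volume z hr).ne'
  have hbtop : b ≠ ∞ := measure_ball_lt_top.ne
  have hb4 : volume (ball z (4 * r)) = 4 ^ n * b := by
    rw [hb_def, Real.volume_pi_ball _ hr, Real.volume_pi_ball _ (by positivity),
      mul_left_comm, mul_pow, ENNReal.ofReal_mul (by positivity), ENNReal.ofReal_pow (by positivity)]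
    simp
  set w4 := ∫⁻ y in ball z (4 * r), W y with hw4
  set v4 := ∫⁻ y in ball z (4 * r), V y with hv4
  have hr4 : 0 < 4 * r := by linarith
  have hw0 : w4 ≠ 0 := h.setLIntegral_ball_ne_zero z hr4
  have hwtop : w4 ≠ ∞ := h.setLIntegral_ball_ne_top z hr4
  have hv0 : v4 ≠ 0 := h.symm.setLIntegral_ball_ne_zero z hr4
  have hvtop : v4 ≠ ∞ := h.symm.setLIntegral_ball_ne_top z hr4
  have hG : Measurable (centeredMaximal (volume.withDensity V) (fun y => f y * (V y)⁻¹)) :=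
    measurable_centeredMaximal _ (hf.mul h.symm.measurable.inv)
  set A := (∫⁻ y in ball z r, f y) / v4 with hA
  have hAv : ∫⁻ y in ball z r, f y = A * v4 := (ENNReal.div_mul_cancel hv0 hvtop).symm
  have hAH : A ^ (p - 1) * b ≤ ∫⁻ y in ball z r,
      centeredMaximal (volume.withDensity V) (fun y => f y * (V y)⁻¹) y ^ (p - 1) := by
    rw [hb_def, ← setLIntegral_const]
    refine setLIntegral_mono' measurableSet_ball fun y hy => ?_
    exact ENNReal.rpow_le_rpow (h.symm.setLIntegral_div_le_centeredMaximal hf hy) hp1.le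
  have hAT : A ^ (p - 1) * b / w4 ≤ T :=
    (ENNReal.div_le_div_right hAH _).trans
      (h.setLIntegral_div_le_centeredMaximal (hG.pow_const _) hx)
  have hv : v4 ^ (p - 1) ≤ C * (4 ^ n : ℝ≥0∞) ^ p * b ^ p / w4 := by
    rw [ENNReal.le_div_iff_mul_le (Or.inl hw0) (Or.inl hwtop), mul_comm, mul_assoc,
      ← ENNReal.mul_rpow_of_nonneg _ _ hp0, ← hb4]
    exact hb z (4 * r) hr4
  have hbp : b ^ p * (b ^ (p - 1))⁻¹ = b := by
    rw [← ENNReal.rpow_neg, ← ENNReal.rpow_add _ _ hb0 hbtop]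
    convert ENNReal.rpow_one b using 2
    ring
  calc ((∫⁻ y in ball z r, f y) / b) ^ (p - 1)
      = A ^ (p - 1) * v4 ^ (p - 1) * (b ^ (p - 1))⁻¹ := by
        rw [hAv, ENNReal.div_rpow_of_nonneg _ _ hp1.le, ENNReal.mul_rpow_of_nonneg _ _ hp1.le,
          div_eq_mul_inv]
    _ ≤ A ^ (p - 1) * (C * (4 ^ n : ℝ≥0∞) ^ p * b ^ p / w4) * (b ^ (p - 1))⁻¹ := by gcongr
    _ = C * (4 ^ n : ℝ≥0∞) ^ p * (A ^ (p - 1) * (b ^ p * (b ^ (p - 1))⁻¹) / w4) := by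
        simp only [div_eq_mul_inv]; ring
    _ ≤ C * (4 ^ n : ℝ≥0∞) ^ p * T := by rw [hbp]; gcongr

/-- **Muckenhoupt's theorem**: the maximal operator is bounded on `L^p_W` for `W ∈ A_p`. -/
theorem exists_lintegral_ballMaximal_le (h : IsApPair p p' W V) :
    ∃ K : ℝ≥0∞, K ≠ ∞ ∧ ∀ f : (Fin n → ℝ) → ℝ≥0∞, Measurable f →
      ∫⁻ x, ballMaximal f x ^ p * W x ≤ K * ∫⁻ x, f x ^ p * W x := by
  obtain ⟨D, hD, hpt⟩ := h.exists_ballMaximal_rpow_le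
  obtain ⟨K₁, hK₁, hs₁⟩ := exists_strongType_centeredMaximal (α := Fin n → ℝ) h.conj.symm.lt
  obtain ⟨K₂, hK₂, hs₂⟩ := exists_strongType_centeredMaximal (α := Fin n → ℝ) h.conj.lt
  have hp' : 0 ≤ p' := h.conj.symm.nonneg
  refine ⟨D ^ p' * (K₁ * K₂), ENNReal.mul_ne_top (ENNReal.rpow_ne_top_of_nonneg hp' hD)
    (ENNReal.mul_ne_top hK₁ hK₂), fun f hf => ?_⟩
  have hfV : Measurable fun y => f y * (V y)⁻¹ := hf.mul h.symm.measurable.inv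
  set G := centeredMaximal (volume.withDensity V) (fun y => f y * (V y)⁻¹)
  have hG : Measurable G := measurable_centeredMaximal _ hfV
  have hGW : Measurable fun y => G y ^ (p - 1) * (W y)⁻¹ :=
    (hG.pow_const _).mul h.measurable.inv
  set T := centeredMaximal (volume.withDensity W) (fun y => G y ^ (p - 1) * (W y)⁻¹)
  have hT : Measurable T := measurable_centeredMaximal _ hGW
  have hmain : ∀ x, ballMaximal f x ^ p ≤ D ^ p' * T x ^ p' := fun x => by
    rw [← ENNReal.mul_rpow_of_nonneg _ _ hp', ← h.conj.sub_one_mul_conj, ENNReal.rpow_mul]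
    exact ENNReal.rpow_le_rpow (hpt f hf x) hp'
  calc ∫⁻ x, ballMaximal f x ^ p * W x
      ≤ ∫⁻ x, D ^ p' * (T x ^ p' * W x) := lintegral_mono fun x => by
        rw [← mul_assoc]; gcongr; exact hmain x
    _ = D ^ p' * ∫⁻ x, T x ^ p' ∂(volume.withDensity W) := by
        rw [lintegral_const_mul' _ _ (ENNReal.rpow_ne_top_of_nonneg hp' hD),
          lintegral_withDensity_eq_lintegral_mul _ h.measurable (hT.pow_const _)]
        simp only [Pi.mul_apply, mul_comm]
    _ ≤ D ^ p' * (K₁ * ∫⁻ x, (G x ^ (p - 1) * (W x)⁻¹) ^ p' ∂(volume.withDensity W)) := by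
        gcongr; exact hs₁ _ _ hGW
    _ = D ^ p' * (K₁ * ∫⁻ x, G x ^ p ∂(volume.withDensity V)) := by
        congr 2
        rw [lintegral_withDensity_eq_lintegral_mul _ h.measurable (hGW.pow_const _),
          lintegral_withDensity_eq_lintegral_mul _ h.symm.measurable (hG.pow_const _)]
        refine lintegral_congr fun x => ?_
        simp only [Pi.mul_apply]
        rw [mul_comm, ENNReal.mul_inv_rpow_mul (h.ne_zero x) (h.ne_top x) _ hp', ← h.dual_eq,
          ← ENNReal.rpow_mul, h.conj.sub_one_mul_conj, mul_comm]
    _ ≤ D ^ p' * (K₁ * (K₂ * ∫⁻ x, (f x * (V x)⁻¹) ^ p ∂(volume.withDensity V))) := by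
        gcongr; exact hs₂ _ _ hfV
    _ = D ^ p' * (K₁ * K₂) * ∫⁻ x, f x ^ p * W x := by
        rw [mul_assoc, mul_assoc]
        congr 3
        rw [lintegral_withDensity_eq_lintegral_mul _ h.symm.measurable (hfV.pow_const _)]
        refine lintegral_congr fun x => ?_
        simp only [Pi.mul_apply]
        rw [mul_comm, ENNReal.mul_inv_rpow_mul (h.symm.ne_zero x) (h.symm.ne_top x) _ h.conj.nonneg,
          ← h.symm.dual_eq]

end IsApPair

/-- The **Rubio de Francia algorithm**: if the maximal operator is bounded on `L^p_W`, then every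
element of this space has an `A₁` majorant in the same space. -/
theorem exists_A1_majorant {n : ℕ} {p : ℝ} (hp : 0 < p) {W : (Fin n → ℝ) → ℝ≥0∞}
    (hW : Measurable W) {K : ℝ≥0∞} (hK : K ≠ ∞)
    (hM : ∀ f : (Fin n → ℝ) → ℝ≥0∞, Measurable f →
      ∫⁻ x, ballMaximal f x ^ p * W x ≤ K * ∫⁻ x, f x ^ p * W x)
    {f : (Fin n → ℝ) → ℝ≥0∞} (hf : Measurable f) (hfin : ∫⁻ x, f x ^ p * W x ≠ ∞) :
    ∃ F : (Fin n → ℝ) → ℝ≥0∞, Measurable F ∧ (∀ x, f x ≤ F x) ∧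
      (∃ c : ℝ≥0∞, c ≠ 0 ∧ c ≠ ∞ ∧ ∀ x, ballMaximal F x ≤ c * F x) ∧
      ∫⁻ x, F x ^ p * W x ≠ ∞ := by
  have hK0 : 2 * (K + 1) ≠ 0 := by simp
  set δ : ℝ≥0∞ := ((2 * (K + 1))⁻¹) ^ p⁻¹ with hδ
  have hδ0 : δ ≠ 0 := by
    simp [hδ, ENNReal.rpow_eq_zero_iff, hK, ENNReal.mul_eq_top]
  have hδtop : δ ≠ ∞ :=
    ENNReal.rpow_ne_top_of_nonneg (inv_nonneg.2 hp.le) (ENNReal.inv_ne_top.2 hK0)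
  have hδK : δ ^ p * K ≤ 2⁻¹ := by
    rw [hδ, ENNReal.rpow_inv_rpow hp.ne', mul_comm, ← div_eq_mul_inv]
    refine ENNReal.div_le_of_le_mul ?_
    rw [ENNReal.inv_mul_cancel_left (by simp) (by simp)]
    exact le_self_add
  let a : ℕ → (Fin n → ℝ) → ℝ≥0∞ := fun k => Nat.rec f (fun _ g x => δ * ballMaximal g x) k
  have ha_succ : ∀ k x, a (k + 1) x = δ * ballMaximal (a k) x := fun _ _ => rfl
  have ha : ∀ k, Measurable (a k) := fun k => by
    cases k with
    | zero => exact hf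
    | succ k => exact (measurable_ballMaximal (a k)).const_mul δ
  have haW : ∀ k, Measurable fun x => a k x ^ p * W x := fun k => ((ha k).pow_const p).mul hW
  have hint : ∀ k, ∫⁻ x, a k x ^ p * W x ≤ 2⁻¹ ^ k * ∫⁻ x, f x ^ p * W x := fun k => by
    induction k with
    | zero => simp [a]
    | succ k ih =>
      calc ∫⁻ x, a (k + 1) x ^ p * W x
          = δ ^ p * ∫⁻ x, ballMaximal (a k) x ^ p * W x := by
            rw [← lintegral_const_mul' _ _ (ENNReal.rpow_ne_top_of_nonneg hp.le hδtop)]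
            refine lintegral_congr fun x => ?_
            rw [ha_succ, ENNReal.mul_rpow_of_nonneg _ _ hp.le, mul_assoc]
        _ ≤ δ ^ p * (K * (2⁻¹ ^ k * ∫⁻ x, f x ^ p * W x)) := by
            gcongr; exact (hM _ (ha k)).trans (by gcongr)
        _ = (δ ^ p * K) * (2⁻¹ ^ k * ∫⁻ x, f x ^ p * W x) := by rw [mul_assoc]
        _ ≤ 2⁻¹ * (2⁻¹ ^ k * ∫⁻ x, f x ^ p * W x) := by gcongr
        _ = _ := by rw [pow_succ']; ring
  have hgeom : ∑' k : ℕ, (2⁻¹ : ℝ≥0∞) ^ k = 2 := by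
    rw [ENNReal.tsum_geometric, ENNReal.one_sub_inv_two, inv_inv]
  refine ⟨fun x => ∑' k, 2⁻¹ ^ k * a k x, Measurable.tsum fun k => (ha k).const_mul _,
    fun x => ?_, ⟨2 * δ⁻¹, by simp [hδtop], ENNReal.mul_ne_top (by simp) (by simp [hδ0]),
      fun x => ?_⟩, ?_⟩
  · simpa [a] using ENNReal.le_tsum (f := fun k => 2⁻¹ ^ k * a k x) 0
  · calc ballMaximal (fun y => ∑' k, 2⁻¹ ^ k * a k y) x
        ≤ ∑' k : ℕ, 2⁻¹ ^ k * ballMaximal (a k) x := ballMaximal_tsum_le _ ha x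
      _ = ∑' k : ℕ, 2 * δ⁻¹ * (2⁻¹ ^ (k + 1) * a (k + 1) x) := by
          refine tsum_congr fun k => ?_
          rw [ha_succ, pow_succ']
          calc _ = (2 * 2⁻¹) * (δ⁻¹ * δ) * (2⁻¹ ^ k * ballMaximal (a k) x) := by
                rw [ENNReal.inv_mul_cancel hδ0 hδtop, ENNReal.mul_inv_cancel (by simp) (by simp)]
                simp
            _ = _ := by ring
      _ = 2 * δ⁻¹ * ∑' k : ℕ, 2⁻¹ ^ (k + 1) * a (k + 1) x := ENNReal.tsum_mul_left
      _ ≤ 2 * δ⁻¹ * ∑' k : ℕ, 2⁻¹ ^ k * a k x := by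
          gcongr 2 * δ⁻¹ * ?_
          exact ENNReal.tsum_comp_le_tsum_of_injective (add_left_injective 1)
            (fun k => 2⁻¹ ^ k * a k x)
  · have hpt : ∀ x, (∑' k : ℕ, 2⁻¹ ^ k * a k x) ^ p ≤ 2 ^ p * ∑' k, a k x ^ p := fun x => by
      calc (∑' k : ℕ, 2⁻¹ ^ k * a k x) ^ p ≤ (∑' k : ℕ, 2⁻¹ ^ k * ⨆ j, a j x) ^ p := by
            gcongr with k; exact le_iSup (fun j => a j x) k
        _ = 2 ^ p * (⨆ j, a j x) ^ p := by
            rw [ENNReal.tsum_mul_right, hgeom, ENNReal.mul_rpow_of_nonneg _ _ hp.le]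
        _ = 2 ^ p * ⨆ j, a j x ^ p := by
            congr 1; exact (ENNReal.orderIsoRpow p hp).map_iSup _
        _ ≤ _ := by
            gcongr; exact iSup_le fun j => ENNReal.le_tsum (f := fun k => a k x ^ p) j
    refine ne_top_of_le_ne_top (b := 2 ^ p * (2 * ∫⁻ x, f x ^ p * W x)) ?_ ?_
    · have := ENNReal.rpow_ne_top_of_nonneg hp.le (show (2 : ℝ≥0∞) ≠ ∞ by simp)
      finiteness
    calc ∫⁻ x, (∑' k : ℕ, 2⁻¹ ^ k * a k x) ^ p * W x
        ≤ ∫⁻ x, 2 ^ p * ∑' k, a k x ^ p * W x := lintegral_mono fun x => by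
          rw [ENNReal.tsum_mul_right, ← mul_assoc]; gcongr; exact hpt x
      _ = 2 ^ p * ∑' k, ∫⁻ x, a k x ^ p * W x := by
          rw [lintegral_const_mul _ (Measurable.tsum haW),
            lintegral_tsum fun k => (haW k).aemeasurable]
      _ ≤ 2 ^ p * ∑' k : ℕ, 2⁻¹ ^ k * ∫⁻ x, f x ^ p * W x := by
          gcongr with k; exact hint k
      _ = _ := by rw [ENNReal.tsum_mul_right, hgeom]

section Cubes

variable {n : ℕ}

theorem closedBall_eq_pi_Icc (z : Fin n → ℝ) {r : ℝ} (hr : 0 ≤ r) :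
    closedBall z r = univ.pi fun i => Icc (z i - r) (z i - r + 2 * r) := by
  rw [closedBall_pi _ hr]
  refine pi_congr rfl fun i _ => ?_
  rw [Real.closedBall_eq_Icc]
  congr 1
  ring

theorem isCube_closedBall (z : Fin n → ℝ) {r : ℝ} (hr : 0 < r) : IsCube (closedBall z r) :=
  ⟨fun i => z i - r, 2 * r, by positivity, closedBall_eq_pi_Icc z hr.le⟩

theorem IsCube.exists_eq_closedBall {Q : Set (Fin n → ℝ)} (hQ : IsCube Q) :
    ∃ (z : Fin n → ℝ) (r : ℝ), 0 < r ∧ Q = closedBall z r := by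
  obtain ⟨a, l, hl, rfl⟩ := hQ
  refine ⟨fun i => a i + l / 2, l / 2, by positivity, ?_⟩
  rw [closedBall_eq_pi_Icc _ (by positivity)]
  refine pi_congr rfl fun i _ => ?_
  congr 1 <;> ring

theorem ball_ae_eq_closedBall (z : Fin n → ℝ) {r : ℝ} (hr : 0 < r) :
    ball z r =ᵐ[volume] closedBall z r := by
  rw [← ball_union_sphere]
  exact (union_ae_eq_left_of_ae_eq_empty
    (ae_eq_empty.2 (Measure.addHaar_sphere_of_ne_zero volume z hr.ne'))).symm

theorem MemA.exists_isApPair {p : ℝ} (hp : 1 < p) {w : (Fin n → ℝ) → ℝ} (h : MemA univ p w) :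
    ∃ W V : (Fin n → ℝ) → ℝ≥0∞, IsApPair p (p / (p - 1)) W V ∧
      ∀ᵐ x, W x = ENNReal.ofReal (w x) := by
  obtain ⟨rfl, -⟩ | ⟨-, hw, C, hC, hb⟩ := h
  · exact absurd hp (lt_irrefl _)
  have hpos : ∀ᵐ x, 0 < w x := by simpa using hw.pos
  let W : (Fin n → ℝ) → ℝ≥0∞ := fun x => if 0 < w x then ENNReal.ofReal (w x) else 1
  have hW : ∀ᵐ x, W x = ENNReal.ofReal (w x) := by
    filter_upwards [hpos] with x hx using if_pos hx
  have hV : ∀ᵐ x, W x ^ (1 - p / (p - 1)) = ENNReal.ofReal (w x ^ (1 - p / (p - 1))) := by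
    filter_upwards [hpos, hW] with x hx hx'
    rw [hx', ENNReal.ofReal_rpow_of_pos hx]
  have hconj : p.HolderConjugate (p / (p - 1)) := Real.HolderConjugate.conjExponent hp
  refine ⟨W, fun x => W x ^ (1 - p / (p - 1)), ⟨hconj, ?_, fun x => ?_, fun x => ?_, fun _ => rfl,
    C, hC, fun z r hr => ?_⟩, hW⟩
  · exact Measurable.ite (measurableSet_lt measurable_const hw.measurable)
      hw.measurable.ennreal_ofReal measurable_const
  · dsimp only [W]
    split_ifs with hx
    · simpa using hx
    · simp
  · dsimp only [W]
    split_ifs <;> simp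
  · have hQ := hb _ (isCube_closedBall z hr) (subset_univ _)
    have hae := ball_ae_eq_closedBall z hr
    rw [← measure_congr hae, ← setLIntegral_congr hae, ← setLIntegral_congr hae,
      ← lintegral_congr_ae (ae_restrict_of_ae hW), ← lintegral_congr_ae (ae_restrict_of_ae hV),
      ENNReal.mul_rpow_of_nonneg _ _ hconj.sub_one_pos.le] at hQ
    set b := volume (ball z r)
    have hb0 : b ≠ 0 := (measure_ball_pos volume z hr).ne'
    have hbtop : b ≠ ∞ := measure_ball_lt_top.ne
    have hbp : b⁻¹ * b⁻¹ ^ (p - 1) = (b ^ p)⁻¹ := by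
      rw [← ENNReal.inv_rpow]
      conv_lhs => rw [← ENNReal.rpow_one b⁻¹, ← ENNReal.rpow_mul, one_mul]
      rw [← ENNReal.rpow_add _ _ (by simpa using hbtop) (by simpa using hb0), add_sub_cancel]
    rw [← ENNReal.div_le_iff_le_mul (Or.inl ?_) (Or.inl ?_), div_eq_mul_inv, ← hbp]
    · convert hQ using 1
      ring
    · simp [ENNReal.rpow_eq_zero_iff, hb0, hbtop]
    · simp [ENNReal.rpow_eq_top_iff, hb0, hbtop]

theorem memA_of_A1_pair {q : ℝ} (hq : 1 < q) {F G : (Fin n → ℝ) → ℝ≥0∞}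
    (hF : Measurable F) (hG : Measurable G) (hF0 : ∀ x, F x ≠ 0) (hG0 : ∀ x, G x ≠ 0)
    (hFtop : ∀ᵐ x, F x ≠ ∞) (hGtop : ∀ᵐ x, G x ≠ ∞)
    (hFM : ∃ c : ℝ≥0∞, c ≠ 0 ∧ c ≠ ∞ ∧ ∀ x, ballMaximal F x ≤ c * F x)
    (hGM : ∃ c : ℝ≥0∞, c ≠ 0 ∧ c ≠ ∞ ∧ ∀ x, ballMaximal G x ≤ c * G x) :
    MemA univ q fun x => (F x ^ (1 - q) * G x).toReal := by
  obtain ⟨c, hc0, hc, hcF⟩ := hFM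
  obtain ⟨d, hd0, hd, hdG⟩ := hGM
  have hq1 : 0 < q - 1 := by linarith
  have hs : 1 - q / (q - 1) = -(q - 1)⁻¹ := by field_simp; ring
  have hneg : ∀ {a b : ℝ≥0∞} {s : ℝ}, 0 ≤ s → a ≤ b → b ^ (-s) ≤ a ^ (-s) := fun hs hab => by
    rw [ENNReal.rpow_neg, ENNReal.rpow_neg]
    exact ENNReal.inv_le_inv.2 (ENNReal.rpow_le_rpow hab hs)
  have hutop : ∀ᵐ x, F x ^ (1 - q) * G x ≠ ∞ := by
    filter_upwards [hFtop, hGtop] with x hx hy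
    refine ENNReal.mul_ne_top ?_ hy
    simp [ENNReal.rpow_eq_top_iff, hF0 x, hx]
  have hu : ∀ᵐ x, ENNReal.ofReal (F x ^ (1 - q) * G x).toReal = F x ^ (1 - q) * G x := by
    filter_upwards [hutop] with x hx using ENNReal.ofReal_toReal hx
  have hu' : ∀ᵐ x, ENNReal.ofReal ((F x ^ (1 - q) * G x).toReal ^ (1 - q / (q - 1))) =
      F x * G x ^ (-(q - 1)⁻¹) := by
    filter_upwards [hFtop, hGtop, hutop] with x hx hy hxy
    have h1 : F x ^ (1 - q) ≠ 0 := by simp [ENNReal.rpow_eq_zero_iff, hF0 x, hx]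
    have h1' : F x ^ (1 - q) ≠ ∞ := by simp [ENNReal.rpow_eq_top_iff, hF0 x, hx]
    rw [← ENNReal.ofReal_rpow_of_pos (ENNReal.toReal_pos (mul_ne_zero h1 (hG0 x)) hxy),
      ENNReal.ofReal_toReal hxy, hs, ENNReal.mul_rpow_of_ne_top h1' hy, ← ENNReal.rpow_mul]
    congr 1
    convert ENNReal.rpow_one (F x) using 2
    field_simp
    ring
  have hmeas : Measurable fun x => F x ^ (1 - q) * G x := (hF.pow_const _).mul hG
  have havg : ∀ {H : (Fin n → ℝ) → ℝ≥0∞} {e : ℝ≥0∞}, Measurable H → (∀ x, H x ≠ 0) →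
      (∀ᵐ x, H x ≠ ∞) → e ≠ ∞ → (∀ x, ballMaximal H x ≤ e * H x) → ∀ z : Fin n → ℝ, ∀ r, 0 < r →
      (volume (ball z r))⁻¹ * (∫⁻ y in ball z r, H y) ≠ 0 ∧
      (volume (ball z r))⁻¹ * (∫⁻ y in ball z r, H y) ≠ ∞ ∧
      ∀ x ∈ ball z r, (volume (ball z r))⁻¹ * (∫⁻ y in ball z r, H y) ≤ e * H x := by
    intro H e hH hH0 hHtop he hM z r hr
    have hle : ∀ x ∈ ball z r, (volume (ball z r))⁻¹ * (∫⁻ y in ball z r, H y) ≤ e * H x :=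
      fun x hx => by
        rw [mul_comm, ← div_eq_mul_inv]
        exact (average_le_ballMaximal H hx).trans (hM x)
    refine ⟨mul_ne_zero (by simpa using measure_ball_lt_top.ne) ?_, ?_, hle⟩
    · rw [← pos_iff_ne_zero, lintegral_pos_iff_support hH]
      have : Function.support H = univ := eq_univ_of_forall hH0
      simpa [this] using measure_ball_pos volume z hr
    · have hfreq : ∃ᶠ x in ae volume, x ∈ ball z r :=
        frequently_ae_mem_iff.2 (measure_ball_pos volume z hr).ne'
      obtain ⟨x, hx, hx'⟩ := (hfreq.and_eventually hHtop).exists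
      exact ne_top_of_le_ne_top (ENNReal.mul_ne_top he hx') (hle x hx)
  have hint : ∀ z : Fin n → ℝ, ∀ r, 0 < r →
      (volume (ball z r))⁻¹ * (∫⁻ x in ball z r, F x ^ (1 - q) * G x) ≤
        ((volume (ball z r))⁻¹ * (∫⁻ y in ball z r, F y) / c) ^ (1 - q) *
          ((volume (ball z r))⁻¹ * (∫⁻ y in ball z r, G y)) := by
    intro z r hr
    obtain ⟨-, -, hφ⟩ := havg hF hF0 hFtop hc hcF z r hr
    rw [mul_left_comm, ← lintegral_const_mul _ hG]
    gcongr _ * ?_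
    refine setLIntegral_mono' measurableSet_ball fun x hx => ?_
    refine mul_le_mul' ?_ le_rfl
    rw [show 1 - q = -(q - 1) by ring]
    exact hneg hq1.le (ENNReal.div_le_of_le_mul' (hφ x hx))
  have hint' : ∀ z : Fin n → ℝ, ∀ r, 0 < r →
      (volume (ball z r))⁻¹ * (∫⁻ x in ball z r, F x * G x ^ (-(q - 1)⁻¹)) ≤
        ((volume (ball z r))⁻¹ * (∫⁻ y in ball z r, G y) / d) ^ (-(q - 1)⁻¹) *
          ((volume (ball z r))⁻¹ * (∫⁻ y in ball z r, F y)) := by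
    intro z r hr
    obtain ⟨-, -, hγ⟩ := havg hG hG0 hGtop hd hdG z r hr
    rw [mul_left_comm, ← lintegral_const_mul _ hF]
    gcongr _ * ?_
    refine setLIntegral_mono' measurableSet_ball fun x hx => ?_
    rw [mul_comm]
    refine mul_le_mul' ?_ le_rfl
    exact hneg (inv_nonneg.2 hq1.le) (ENNReal.div_le_of_le_mul' (hγ x hx))
  refine Or.inr ⟨hq, ⟨hmeas.ennreal_toReal, ?_, fun Q hQ _ => ?_⟩, c ^ (q - 1) * d,
    ENNReal.mul_ne_top (ENNReal.rpow_ne_top_of_nonneg hq1.le hc) hd, fun Q hQ _ => ?_⟩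
  · rw [Measure.restrict_univ]
    filter_upwards [hFtop, hutop] with x hx hxy
    refine ENNReal.toReal_pos (mul_ne_zero ?_ (hG0 x)) hxy
    simp [ENNReal.rpow_eq_zero_iff, hF0 x, hx]
  · obtain ⟨z, r, hr, rfl⟩ := hQ.exists_eq_closedBall
    obtain ⟨hφ0, hφtop, -⟩ := havg hF hF0 hFtop hc hcF z r hr
    obtain ⟨hγ0, hγtop, -⟩ := havg hG hG0 hGtop hd hdG z r hr
    refine integrable_toReal_of_lintegral_ne_top hmeas.aemeasurable ?_
    rw [← setLIntegral_congr (ball_ae_eq_closedBall z hr)]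
    have htop : (volume (ball z r))⁻¹ * (∫⁻ x in ball z r, F x ^ (1 - q) * G x) ≠ ∞ := by
      refine ne_top_of_le_ne_top (ENNReal.mul_ne_top ?_ hγtop) (hint z r hr)
      simp [ENNReal.rpow_eq_top_iff, ENNReal.div_eq_top, ENNReal.div_eq_zero_iff, hφ0, hφtop, hc, hc0]
    intro h
    rw [h, ENNReal.mul_top (by simpa using measure_ball_lt_top.ne)] at htop
    exact htop rfl
  · obtain ⟨z, r, hr, rfl⟩ := hQ.exists_eq_closedBall
    obtain ⟨hφ0, hφtop, -⟩ := havg hF hF0 hFtop hc hcF z r hr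
    obtain ⟨hγ0, hγtop, -⟩ := havg hG hG0 hGtop hd hdG z r hr
    have hae := ball_ae_eq_closedBall z hr
    rw [← measure_congr hae, ← setLIntegral_congr hae, ← setLIntegral_congr hae,
      lintegral_congr_ae (ae_restrict_of_ae hu), lintegral_congr_ae (ae_restrict_of_ae hu')]
    refine (mul_le_mul' (hint z r hr) (ENNReal.rpow_le_rpow (hint' z r hr) hq1.le)).trans ?_
    set φ := (volume (ball z r))⁻¹ * (∫⁻ y in ball z r, F y)
    set γ := (volume (ball z r))⁻¹ * (∫⁻ y in ball z r, G y)
    have hφq : φ ^ (q - 1) ≠ 0 := by simp [ENNReal.rpow_eq_zero_iff, hφ0, hφtop]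
    have hφq' : φ ^ (q - 1) ≠ ∞ := ENNReal.rpow_ne_top_of_nonneg hq1.le hφtop
    rw [show 1 - q = -(q - 1) by ring, ENNReal.mul_rpow_of_nonneg _ _ hq1.le, ← ENNReal.rpow_mul,
      neg_mul, inv_mul_cancel₀ hq1.ne', ENNReal.rpow_neg_one, ENNReal.rpow_neg,
      ENNReal.div_rpow_of_nonneg _ _ hq1.le, ENNReal.inv_div (Or.inl ?_) (Or.inl ?_),
      ENNReal.inv_div (Or.inl hd) (Or.inl hd0), div_eq_mul_inv, div_eq_mul_inv]
    · calc _ = c ^ (q - 1) * d * ((φ ^ (q - 1))⁻¹ * φ ^ (q - 1)) * (γ⁻¹ * γ) := by ring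
        _ ≤ _ := by
          rw [ENNReal.inv_mul_cancel hφq hφq', ENNReal.inv_mul_cancel hγ0 hγtop, mul_one, mul_one]
    · exact ENNReal.rpow_ne_top_of_nonneg hq1.le hc
    · simp [ENNReal.rpow_eq_zero_iff, hc0, hc]

end Cubes

namespace IsApPair

variable {n : ℕ} {p p' : ℝ} {W V : (Fin n → ℝ) → ℝ≥0∞}

theorem exists_pos_lintegral_ne_top (h : IsApPair p p' W V) :
    ∃ g : (Fin n → ℝ) → ℝ≥0∞, Measurable g ∧ (∀ x, g x ≠ 0) ∧ ∫⁻ x, g x ^ p * W x ≠ ∞ := by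
  obtain ⟨k, hk0, hk, hkint⟩ :=
    exists_pos_lintegral_lt_of_sigmaFinite (volume : Measure (Fin n → ℝ)) one_ne_zero
  refine ⟨fun x => (k x * (W x)⁻¹) ^ p⁻¹,
    (hk.coe_nnreal_ennreal.mul h.measurable.inv).pow_const _, fun x => ?_, ?_⟩
  · simp [ENNReal.rpow_eq_zero_iff, (hk0 x).ne', h.ne_top x, h.ne_zero x, ENNReal.mul_eq_top]
  · refine ne_top_of_le_ne_top hkint.ne_top (lintegral_mono fun x => ?_)
    dsimp only
    rw [ENNReal.rpow_inv_rpow h.conj.ne_zero, mul_assoc,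
      ENNReal.inv_mul_cancel (h.ne_zero x) (h.ne_top x), mul_one]

/-- Every element of `L^p_W` with `W ∈ A_p` has an everywhere positive `A₁` majorant in `L^p_W`. -/
theorem exists_A1_majorant (h : IsApPair p p' W V) {f : (Fin n → ℝ) → ℝ≥0∞} (hf : Measurable f)
    (hfin : ∫⁻ x, f x ^ p * W x ≠ ∞) :
    ∃ F : (Fin n → ℝ) → ℝ≥0∞, Measurable F ∧ (∀ x, f x ≤ F x) ∧ (∀ x, F x ≠ 0) ∧
      (∀ᵐ x, F x ≠ ∞) ∧ (∃ c : ℝ≥0∞, c ≠ 0 ∧ c ≠ ∞ ∧ ∀ x, ballMaximal F x ≤ c * F x) ∧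
      ∫⁻ x, F x ^ p * W x ≠ ∞ := by
  obtain ⟨g, hg, hg0, hgint⟩ := h.exists_pos_lintegral_ne_top
  obtain ⟨K, hK, hM⟩ := h.exists_lintegral_ballMaximal_le
  have hfg : ∫⁻ x, max (f x) (g x) ^ p * W x ≠ ∞ := by
    refine ne_top_of_le_ne_top (ENNReal.add_ne_top.2 ⟨hfin, hgint⟩) ?_
    have hfW : Measurable fun x => f x ^ p * W x := (hf.pow_const _).mul h.measurable
    rw [← lintegral_add_left hfW]
    refine lintegral_mono fun x => ?_
    rw [← add_mul]
    gcongr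
    rcases max_choice (f x) (g x) with hx | hx <;> rw [hx]
    · exact le_self_add
    · exact le_add_self
  obtain ⟨F, hF, hle, hA1, hint⟩ :=
    _root_.exists_A1_majorant h.conj.pos h.measurable hK hM (hf.max hg) hfg
  refine ⟨F, hF, fun x => (le_max_left _ _).trans (hle x), fun x hx => ?_, ?_, hA1, hint⟩
  · exact hg0 x (le_zero_iff.1 (hx ▸ (le_max_right _ _).trans (hle x)))
  · have hFW : Measurable fun x => F x ^ p * W x := (hF.pow_const _).mul h.measurable
    filter_upwards [ae_lt_top hFW hint] with x hx hx'
    rw [hx', ENNReal.top_rpow_of_pos h.conj.pos, ENNReal.top_mul (h.ne_zero x)] at hx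
    exact hx.false

theorem lintegral_mul_ne_top (h : IsApPair p p' W V) {F G : (Fin n → ℝ) → ℝ≥0∞}
    (hF : Measurable F) (hFint : ∫⁻ x, F x ^ p * W x ≠ ∞) (hGint : ∫⁻ x, G x ^ p' * V x ≠ ∞) :
    ∫⁻ x, F x * G x ≠ ∞ := by
  have hp0 : ENNReal.ofReal p ≠ 0 := by simpa using h.conj.pos
  have hp0' : ENNReal.ofReal p' ≠ 0 := by simpa using h.conj.symm.pos
  refine ne_top_of_le_ne_top (ENNReal.add_ne_top.2
    ⟨ENNReal.mul_ne_top (ENNReal.inv_ne_top.2 hp0) hFint,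
      ENNReal.mul_ne_top (ENNReal.inv_ne_top.2 hp0') hGint⟩) ?_
  have hFW : Measurable fun x => (ENNReal.ofReal p)⁻¹ * (F x ^ p * W x) :=
    ((hF.pow_const _).mul h.measurable).const_mul _
  rw [← lintegral_const_mul' _ _ (ENNReal.inv_ne_top.2 hp0),
    ← lintegral_const_mul' _ _ (ENNReal.inv_ne_top.2 hp0'),
    ← lintegral_add_left hFW]
  refine lintegral_mono fun x => ?_
  calc F x * G x = F x * (G x * (W x)⁻¹) * W x := by
        rw [mul_assoc, mul_assoc, ENNReal.inv_mul_cancel (h.ne_zero x) (h.ne_top x), mul_one]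
    _ ≤ (F x ^ p / ENNReal.ofReal p + (G x * (W x)⁻¹) ^ p' / ENNReal.ofReal p') * W x := by
        gcongr; exact ENNReal.young_inequality _ _ h.conj
    _ = (ENNReal.ofReal p)⁻¹ * (F x ^ p * W x) +
          (ENNReal.ofReal p')⁻¹ * ((G x * (W x)⁻¹) ^ p' * W x) := by
        simp only [div_eq_mul_inv]; ring
    _ = _ := by
        rw [ENNReal.mul_inv_rpow_mul (h.ne_zero x) (h.ne_top x) _ h.conj.symm.nonneg, ← h.dual_eq]

end IsApPair

theorem exists_memA_memLw {n : ℕ} {p q : ℝ} (hp : 1 < p) (hq : 1 < q) {w f : (Fin n → ℝ) → ℝ}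
    (hw : MemA univ p w) (hf : MemLw univ p w f) :
    ∃ v, MemA univ q v ∧ MemLw univ q v f := by
  obtain ⟨W, V, h, hWw⟩ := hw.exists_isApPair hp
  obtain ⟨hfm, hfint⟩ := hf
  have hfm' : Measurable fun x => ENNReal.ofReal |f x| := hfm.abs.ennreal_ofReal
  have hfW : ∫⁻ x, ENNReal.ofReal |f x| ^ p * W x ≠ ∞ := by
    rw [Measure.restrict_univ] at hfint
    convert hfint.ne using 1
    refine lintegral_congr_ae ?_
    filter_upwards [hWw] with x hx
    rw [hx]
  obtain ⟨F, hF, hfF, hF0, hFtop, hF1, hFint⟩ := h.exists_A1_majorant hfm' hfW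
  obtain ⟨G, hG, -, hG0, hGtop, hG1, hGint⟩ := h.symm.exists_A1_majorant (f := 0)
    measurable_const (by simp [h.conj.symm.pos])
  refine ⟨_, memA_of_A1_pair hq hF hG hF0 hG0 hFtop hGtop hF1 hG1, hfm, ?_⟩
  rw [Measure.restrict_univ]
  refine lt_of_le_of_lt (lintegral_mono_ae ?_) (h.lintegral_mul_ne_top hF hFint hGint).lt_top
  filter_upwards [hFtop] with x hx
  calc ENNReal.ofReal |f x| ^ q * ENNReal.ofReal (F x ^ (1 - q) * G x).toReal
      ≤ F x ^ q * (F x ^ (1 - q) * G x) := by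
        gcongr
        · exact hfF x
        · exact ENNReal.ofReal_toReal_le
    _ = F x * G x := by
        rw [← mul_assoc, ← ENNReal.rpow_add _ _ (hF0 x) hx, add_sub_cancel, ENNReal.rpow_one]

theorem stmt9 (n : ℕ) (p q : ℝ) (hp : 1 < p) (hq : 1 < q) :
    {f : (Fin n → ℝ) → ℝ | ∃ w, MemA Set.univ p w ∧ MemLw Set.univ p w f} =
      {f | ∃ w, MemA Set.univ q w ∧ MemLw Set.univ q w f} := by
  ext f
  exact ⟨fun ⟨_, hw, hf⟩ => exists_memA_memLw hp hq hw hf,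
    fun ⟨_, hw, hf⟩ => exists_memA_memLw hq hp hw hf⟩
end
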